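/- Let d ≥ 3, u > 0 and ε ∈ (0,1). There exist constants c = c(d,u,ε) > 0 and C = C(d,u,ε) < ∞ such that the following holds for every finite nonempty set A ⊆ Z^d and every positive integer T. Let N be a Poisson random variable with parameter u·cap(A); conditionally on N, let X_1, ..., X_N be independent simple random walks on Z^d whose starting points X_1(0), ..., X_N(0) are i.i.d. with distribution the normalized equilibrium measure ẽ_A. Set Ψ = ∪_{i=1}^N {X_i(t) : 1 ≤ t ≤ T}. Then P[ cap(Ψ) ≥ c · min( cap(A) T^{(1−ε)/2}, T^{(d−2)(1−ε)/2} ) ] ≥ 1 − C exp( −c · min(T^{ε/2}, cap(A)) ). -/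

import Mathlib

open MeasureTheory ProbabilityTheory
open scoped ENNReal NNReal

/-- Points of the lattice `ℤ^d`. -/
abbrev Zd (d : ℕ) := Fin d → ℤ

/-- The `ℓ^∞` norm of a lattice point. -/
def norminf {d : ℕ} (x : Zd d) : ℕ := Finset.univ.sup fun j => (x j).natAbs

/-- `x` and `y` are nearest neighbours in `ℤ^d` (their `ℓ^1` distance is `1`). -/
def IsStep {d : ℕ} (x y : Zd d) : Prop := (∑ j, (y j - x j).natAbs) = 1

/-- Discrete ball (in `ℤ^d`, `ℓ^∞` distance) with real center and radius. -/
def ballZR (d : ℕ) (c : Fin d → ℝ) (r : ℝ) : Set (Zd d) :=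
  {y | ∀ j, |(y j : ℝ) - c j| ≤ r}

/-- `t`-step transition probability of simple random walk on `ℤ^d`. -/
noncomputable def stepP (d : ℕ) : ℕ → Zd d → Zd d → ℝ
  | 0, x, y => if x = y then 1 else 0
  | n+1, x, y => (∑ j : Fin d,
      (stepP d n (Function.update x j (x j + 1)) y +
       stepP d n (Function.update x j (x j - 1)) y)) / (2 * d)

/-- The Green function of simple random walk on `ℤ^d`. -/
noncomputable def green (d : ℕ) (x y : Zd d) : ℝ := ∑' n : ℕ, stepP d n x y

/-- The energy of a (finitely supported) measure `ν`, carried by the finite set `s`. -/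
noncomputable def energy (d : ℕ) (s : Finset (Zd d)) (ν : Zd d → ℝ) : ℝ :=
  ∑ z ∈ s, ∑ w ∈ s, green d z w * ν z * ν w

/-- The capacity of `K ⊆ ℤ^d`: the inverse of the infimum of the energies of probability
measures carried by `K` (with the conventions `sInf ∅ = 0`, `0⁻¹ = 0`, this gives
`capacity d ∅ = 0`). -/
noncomputable def capacity (d : ℕ) (K : Set (Zd d)) : ℝ :=
  (sInf {E : ℝ | ∃ (s : Finset (Zd d)) (ν : Zd d → ℝ), ↑s ⊆ K ∧
    (∀ z, 0 ≤ ν z) ∧ (∀ z ∉ s, ν z = 0) ∧ (∑ z ∈ s, ν z) = 1 ∧ E = energy d s ν})⁻¹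

open Classical in
/-- `X` is a simple random walk on `ℤ^d` started at `x0`, under the probability measure `P`:
a walk follows nearest-neighbour paths, each of the `(2d)^n` admissible length-`n` paths from
`x0` having probability `(2d)⁻ⁿ`. -/
def IsSRW (d : ℕ) {Ω : Type} [MeasurableSpace Ω] (P : Measure Ω)
    (X : ℕ → Ω → Zd d) (x0 : Zd d) : Prop :=
  (∀ t, Measurable (X t)) ∧
  ∀ (n : ℕ) (w : ℕ → Zd d),
    P {ω | ∀ k ≤ n, X k ω = w k} =
      if w 0 = x0 ∧ ∀ k < n, IsStep (w k) (w (k+1))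
      then ((2 * d : ℝ≥0∞))⁻¹ ^ n else 0

/-- The set `Φ(X̄_N, T)`: all points visited by the walks `X 0, …, X (N-1)` during times
`1, …, T`. -/
def Phi (d : ℕ) {Ω : Type} (X : ℕ → ℕ → Ω → Zd d) (N T : ℕ) (ω : Ω) : Set (Zd d) :=
  {z | ∃ i < N, ∃ t, 1 ≤ t ∧ t ≤ T ∧ X i t ω = z}

/-- The function `F(n,d)` : `√n` for `d = 3`, `log n` for `d = 4`, and `1` for `d ≥ 5`. -/
noncomputable def Ffn (d n : ℕ) : ℝ :=
  if d = 3 then Real.sqrt n else if d = 4 then Real.log n else 1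
open Classical in
/-- `escProb d A n z` is the probability that a simple random walk started at `z` stays
outside `A` at all times `1, …, n`. -/
noncomputable def escProb (d : ℕ) (A : Set (Zd d)) : ℕ → Zd d → ℝ
  | 0, _ => 1
  | n+1, z => (∑ j : Fin d,
      ((if Function.update z j (z j + 1) ∈ A then 0
        else escProb d A n (Function.update z j (z j + 1))) +
       (if Function.update z j (z j - 1) ∈ A then 0
        else escProb d A n (Function.update z j (z j - 1))))) / (2 * d)

open Classical in
/-- The equilibrium measure of `A`: `e_A(z) = P_z[X(t) ∉ A for all t ≥ 1]` for `z ∈ A`,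
and `0` otherwise. -/
noncomputable def eqMeasure (d : ℕ) (A : Set (Zd d)) (z : Zd d) : ℝ :=
  if z ∈ A then ⨅ n : ℕ, escProb d A n z else 0

/-- The normalized equilibrium measure `ẽ_A = e_A / cap(A)`. -/
noncomputable def neqMeasure (d : ℕ) (A : Set (Zd d)) (z : Zd d) : ℝ :=
  eqMeasure d A z / capacity d A

/-- The Poisson(`lam`) probability of the value `n`. -/
noncomputable def poissonProb (lam : ℝ) (n : ℕ) : ℝ :=
  Real.exp (-lam) * lam ^ n / n.factorial

open Classical in
/-- The probability that a simple random walk whose starting point has (sub-)probability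
density `ν` follows the path `w 0, w 1, …, w m` during its first `m` steps. -/
noncomputable def pathProb (d : ℕ) (ν : Zd d → ℝ) (m : ℕ) (w : ℕ → Zd d) : ℝ :=
  if ∀ k < m, IsStep (w k) (w (k+1)) then ν (w 0) * ((2 * (d : ℝ)))⁻¹ ^ m else 0

/-- Under `P`, `N` is Poisson with parameter `u ⬝ cap K` and, given `N`, the walks
`Y 0, …, Y (N-1)` are independent simple random walks whose starting points are i.i.d.
with distribution the normalized equilibrium measure of `K`. -/
def HasLevelLaw (d : ℕ) (u : ℝ) {Ω : Type} [MeasurableSpace Ω] (P : Measure Ω)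
    (K : Set (Zd d)) (N : Ω → ℕ) (Y : ℕ → ℕ → Ω → Zd d) : Prop :=
  (∀ i t, Measurable (Y i t)) ∧ Measurable N ∧
  ∀ (n m : ℕ) (w : ℕ → ℕ → Zd d),
    P {ω | N ω = n ∧ ∀ k < n, ∀ t ≤ m, Y k t ω = w k t} =
      ENNReal.ofReal (poissonProb (u * capacity d K) n *
        ∏ k ∈ Finset.range n, pathProb d (neqMeasure d K) m (w k))

/-- The recursively defined random sets `U⁽ⁱ⁾ = U⁽ⁱ⁾(x,T)`: `U⁽¹⁾` is the range of the walk
`X` during times `1, …, T`, and for `i ≥ 2`, `U⁽ⁱ⁾` is the set of points visited, during times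
`1, …, T`, by the `N i` walks `Y i 0, …, Y i (N i - 1)`. -/
def Uset (d T : ℕ) {Ω : Type} (X : ℕ → Ω → Zd d) (N : ℕ → Ω → ℕ)
    (Y : ℕ → ℕ → ℕ → Ω → Zd d) (i : ℕ) (ω : Ω) : Set (Zd d) :=
  if i ≤ 1 then {z | ∃ t, 1 ≤ t ∧ t ≤ T ∧ X t ω = z}
  else {z | ∃ k < N i ω, ∃ t, 1 ≤ t ∧ t ≤ T ∧ Y i k t ω = z}


open MeasureTheory ProbabilityTheory
open scoped ENNReal NNReal

/-- unit steps -/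
def stepVec {d : ℕ} (b : Fin d × Bool) : Zd d :=
  Pi.single b.1 (if b.2 then 1 else -1)

lemma update_add_single {d : ℕ} (x : Zd d) (j : Fin d) (a : ℤ) :
    Function.update x j (x j + a) = x + Pi.single j a := by
  funext k
  by_cases h : k = j
  · subst h; simp
  · simp [h]

lemma stepP_succ (d n : ℕ) (x y : Zd d) :
    stepP d (n+1) x y = (∑ b : Fin d × Bool, stepP d n (x + stepVec b) y) / (2 * d) := by
  rw [Fintype.sum_prod_type]
  simp only [stepP, Fintype.sum_bool, stepVec]
  congr 1
  refine Finset.sum_congr rfl fun j _ => ?_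
  rw [update_add_single, sub_eq_add_neg, update_add_single]
  simp

lemma stepP_nonneg (d n : ℕ) (x y : Zd d) : 0 ≤ stepP d n x y := by
  induction n generalizing x with
  | zero => simp only [stepP]; split_ifs <;> norm_num
  | succ n ih =>
    rw [stepP_succ]
    exact div_nonneg (Finset.sum_nonneg fun b _ => ih _) (by positivity)

lemma stepP_add (d n : ℕ) (x y z : Zd d) : stepP d n (x + z) (y + z) = stepP d n x y := by
  induction n generalizing x with
  | zero => simp only [stepP, add_left_inj]
  | succ n ih =>
    rw [stepP_succ, stepP_succ]
    congr 1
    refine Finset.sum_congr rfl fun b _ => ?_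
    rw [← ih, add_right_comm]

lemma stepVec_not {d : ℕ} (b : Fin d × Bool) : stepVec (b.1, !b.2) = - stepVec b := by
  rcases b with ⟨j, _ | _⟩ <;> simp [stepVec, ← Pi.single_neg]

/-- flip the sign of a unit step -/
def flipStep (d : ℕ) : Equiv.Perm (Fin d × Bool) :=
  Function.Involutive.toPerm (fun b => (b.1, !b.2)) (fun b => by simp)

lemma stepP_succ_right (d n : ℕ) (x y : Zd d) :
    stepP d (n+1) x y = (∑ b : Fin d × Bool, stepP d n x (y + stepVec b)) / (2 * d) := by
  rw [stepP_succ]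
  congr 1
  refine Fintype.sum_equiv (flipStep d) _ _ fun b => ?_
  have : flipStep d b = (b.1, !b.2) := rfl
  rw [this, stepVec_not, ← stepP_add d n x _ (stepVec b)]
  simp

lemma stepP_symm (d n : ℕ) (x y : Zd d) : stepP d n x y = stepP d n y x := by
  induction n generalizing x with
  | zero => simp only [stepP, eq_comm]
  | succ n ih =>
    rw [stepP_succ, stepP_succ_right]
    simp only [ih]

/-- base measure on one angle -/
noncomputable def angM : Measure ℝ := volume.restrict (Set.Ioc (-Real.pi) Real.pi)

instance : IsFiniteMeasure angM := by unfold angM; infer_instance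

noncomputable def phiF {d : ℕ} (θ : Fin d → ℝ) : ℝ := (∑ j, Real.cos (θ j)) / d

noncomputable def charF {d : ℕ} (z : Zd d) (θ : Fin d → ℝ) : ℂ :=
  ∏ j, Complex.exp (Complex.I * z j * θ j)

lemma angM_char (m : ℤ) :
    ∫ t, Complex.exp (Complex.I * m * t) ∂angM = if m = 0 then 2 * Real.pi else 0 := by
  unfold angM
  rw [← intervalIntegral.integral_of_le (by linarith [Real.pi_pos])]
  split_ifs with h
  · subst h; simp; ring
  · have hc : Complex.I * m ≠ 0 := by simp [h]
    rw [integral_exp_mul_complex hc, sub_eq_zero.2, zero_div]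
    · simp
    rw [Complex.exp_eq_exp_iff_exists_int]
    refine ⟨m, ?_⟩
    push_cast; ring

lemma charF_norm {d : ℕ} (z : Zd d) (θ : Fin d → ℝ) : ‖charF z θ‖ = 1 := by
  unfold charF
  rw [norm_prod]
  refine Finset.prod_eq_one fun j _ => ?_
  rw [show Complex.I * z j * θ j = ((z j * θ j : ℝ) : ℂ) * Complex.I by push_cast; ring]
  exact Complex.norm_exp_ofReal_mul_I _

lemma phiF_abs {d : ℕ} (θ : Fin d → ℝ) : |phiF θ| ≤ 1 := by
  unfold phiF
  rw [abs_div, Nat.abs_cast]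
  apply div_le_one_of_le₀ _ (by positivity)
  calc |∑ j, Real.cos (θ j)| ≤ ∑ j, |Real.cos (θ j)| := Finset.abs_sum_le_sum_abs _ _
    _ ≤ ∑ j : Fin d, 1 := Finset.sum_le_sum fun j _ => Real.abs_cos_le_one _
    _ = d := by simp

lemma charF_cont {d : ℕ} (z : Zd d) : Continuous (charF z) := by
  unfold charF; fun_prop

lemma phiF_cont {d : ℕ} : Continuous (phiF (d := d)) := by
  unfold phiF; fun_prop

lemma four_int {d : ℕ} (n : ℕ) (z : Zd d) :
    Integrable (fun θ => ((phiF θ : ℂ))^n * charF z θ) (Measure.pi fun _ : Fin d => angM) := by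
  refine Integrable.of_bound (C := 1) ?_ ?_
  · have := charF_cont z
    have h2 := phiF_cont (d := d)
    apply Continuous.aestronglyMeasurable
    exact ((Complex.continuous_ofReal.comp h2).pow n).mul this
  · refine Filter.Eventually.of_forall fun θ => ?_
    rw [norm_mul, charF_norm, mul_one, norm_pow, Complex.norm_real]
    exact pow_le_one₀ (norm_nonneg _) (phiF_abs θ)

lemma charF_add {d : ℕ} (z w : Zd d) (θ : Fin d → ℝ) : charF (z + w) θ = charF z θ * charF w θ := by
  unfold charF
  rw [← Finset.prod_mul_distrib]
  refine Finset.prod_congr rfl fun j _ => ?_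
  rw [← Complex.exp_add]; congr 1; simp; ring

lemma charF_single {d : ℕ} (j : Fin d) (a : ℤ) (θ : Fin d → ℝ) :
    charF (Pi.single j a) θ = Complex.exp (Complex.I * a * θ j) := by
  unfold charF
  rw [Finset.prod_eq_single j]
  · simp
  · intro k _ hk; simp [hk]
  · simp

lemma charF_step {d : ℕ} (hd : 0 < d) (z : Zd d) (θ : Fin d → ℝ) :
    ∑ b : Fin d × Bool, charF (z + stepVec b) θ = 2 * d * phiF θ * charF z θ := by
  rw [Fintype.sum_prod_type]
  simp only [Fintype.sum_bool, charF_add, stepVec, charF_single, phiF]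
  have hd' : (d : ℂ) ≠ 0 := by exact_mod_cast hd.ne'
  have : ∀ j : Fin d, Complex.exp (Complex.I * ((1 : ℤ) : ℂ) * θ j)
     + Complex.exp (Complex.I * ((-1 : ℤ) : ℂ) * θ j)
      = 2 * Complex.cos (θ j) := by
    intro j
    rw [Complex.two_cos]; simp [mul_comm]
  simp only [← mul_add, if_true, Bool.false_eq_true, if_false, this]
  push_cast
  rw [← Finset.mul_sum, ← Finset.mul_sum]
  field_simp

lemma stepP_fourier {d : ℕ} (hd : 0 < d) (n : ℕ) (x y : Zd d) :
    ∫ θ, ((phiF θ : ℂ))^n * charF (x - y) θ ∂(Measure.pi fun _ : Fin d => angM)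
      = (2 * Real.pi : ℂ)^d * stepP d n x y := by
  induction n generalizing x with
  | zero =>
    simp only [pow_zero, one_mul, charF, stepP]
    rw [MeasureTheory.integral_fintype_prod_eq_prod
      (f := fun j (t : ℝ) => Complex.exp (Complex.I * ((x - y) j : ℤ) * t))]
    simp only [angM_char]
    split_ifs with h
    · subst h; simp
    · obtain ⟨j, hj⟩ := Function.ne_iff.1 h
      rw [Finset.prod_eq_zero (Finset.mem_univ j)]
      · simp
      · simp [sub_eq_zero, hj]
  | succ n ih =>
    have hd' : (d : ℂ) ≠ 0 := by exact_mod_cast hd.ne'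
    rw [stepP_succ]
    push_cast
    rw [mul_div_assoc', Finset.mul_sum, eq_div_iff (by simp [hd'])]
    simp only [← ih]
    rw [← integral_finsetSum _ (fun b _ => four_int n _), ← integral_mul_const]
    congr 1
    funext θ
    simp only [add_sub_right_comm]
    rw [← Finset.mul_sum, charF_step hd]
    ring

lemma sin_sq_bound (a : ℝ) (ha : 0 < a) :
    ∫ t, Real.exp (-a * Real.sin t ^2) ∂angM ≤ 10 / Real.sqrt a := by
  set b : ℝ := 4 * a / Real.pi^2 with hb
  have hpi := Real.pi_pos
  have hbpos : 0 < b := by positivity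
  have key : ∀ t : ℝ, |t| ≤ Real.pi/2 → Real.exp (-a * Real.sin t ^2) ≤ Real.exp (-b * t^2) := by
    intro t ht
    apply Real.exp_le_exp.2
    have h1 : 2 / Real.pi * |t| ≤ |Real.sin t| := Real.mul_abs_le_abs_sin ht
    have h2 : (2 / Real.pi * |t|)^2 ≤ Real.sin t ^2 := by
      rw [← sq_abs (Real.sin t)]; gcongr
    have h3 : b * t^2 = a * (2 / Real.pi * |t|)^2 := by
      rw [mul_pow, sq_abs, hb]; field_simp; ring
    nlinarith
  have hg : ∀ c : ℝ, Integrable (fun t : ℝ => Real.exp (-b * (t + c)^2)) := fun c =>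
    (integrable_exp_neg_mul_sq hbpos).comp_add_right c
  have hgi : ∀ c : ℝ, ∫ t : ℝ, Real.exp (-b * (t + c)^2) = Real.sqrt (Real.pi / b) := by
    intro c
    rw [integral_add_right_eq_self (fun t : ℝ => Real.exp (-b * t^2)) c, integral_gaussian]
  have hle : ∫ t, Real.exp (-a * Real.sin t ^2) ∂angM ≤
      ∫ t, (Real.exp (-b * (t+0)^2) + Real.exp (-b * (t + Real.pi)^2)
        + Real.exp (-b * (t + -Real.pi)^2)) ∂angM := by
    apply integral_mono_ae
    · refine Integrable.of_bound (C := 1) ?_ ?_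
      · apply Continuous.aestronglyMeasurable; fun_prop
      · refine Filter.Eventually.of_forall fun θ => ?_
        rw [Real.norm_eq_abs, Real.abs_exp, Real.exp_le_one_iff]
        nlinarith [sq_nonneg (Real.sin θ)]
    · exact (((hg 0).add (hg _)).add (hg _)).restrict
    · refine (ae_restrict_mem measurableSet_Ioc).mono fun t ht => ?_
      have e1 := Real.exp_pos (-b * (t+0)^2)
      have e2 := Real.exp_pos (-b * (t+Real.pi)^2)
      have e3 := Real.exp_pos (-b * (t+ -Real.pi)^2)
      show Real.exp (-a * Real.sin t ^2) ≤ Real.exp (-b * (t+0)^2) + Real.exp (-b * (t + Real.pi)^2)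
        + Real.exp (-b * (t + -Real.pi)^2)
      rcases le_total (-(Real.pi/2)) t with h1 | h1
      · rcases le_total t (Real.pi/2) with h2 | h2
        · have := key (t+0) (by rw [abs_le]; constructor <;> linarith)
          rw [add_zero] at this e1 ⊢
          linarith
        · have := key (t + -Real.pi) (by rw [abs_le]; constructor <;> linarith [ht.2])
          rw [← sub_eq_add_neg, Real.sin_sub_pi, neg_sq] at this
          rw [← sub_eq_add_neg] at e3 ⊢
          linarith
      · have := key (t + Real.pi) (by rw [abs_le]; constructor <;> linarith [ht.1])
        rw [Real.sin_add_pi, neg_sq] at this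
        linarith
  refine hle.trans ?_
  have hle2 : ∫ t, (Real.exp (-b * (t+0)^2) + Real.exp (-b * (t + Real.pi)^2)
        + Real.exp (-b * (t + -Real.pi)^2)) ∂angM ≤ ∫ t, (Real.exp (-b * (t+0)^2) + Real.exp (-b * (t + Real.pi)^2)
        + Real.exp (-b * (t + -Real.pi)^2)) := by
    apply integral_mono_measure Measure.restrict_le_self
    · exact Filter.Eventually.of_forall fun t => by positivity
    · exact ((hg 0).add (hg _)).add (hg _)
  refine hle2.trans ?_
  have hs : ∫ t, (Real.exp (-b * (t+0)^2) + Real.exp (-b * (t + Real.pi)^2)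
        + Real.exp (-b * (t + -Real.pi)^2)) = (∫ t, Real.exp (-b * (t+0)^2)) +
        (∫ t, Real.exp (-b * (t+Real.pi)^2)) + ∫ t, Real.exp (-b * (t+ -Real.pi)^2) := by
    rw [← integral_add (hg 0) (hg _)]
    exact integral_add ((hg 0).add (hg _)) (hg _)
  rw [hs]
  simp only [hgi]
  have : Real.sqrt (Real.pi / b) = Real.sqrt (Real.pi^3/4) / Real.sqrt a := by
    rw [← Real.sqrt_div' _ ha.le]; congr 1; rw [hb]; field_simp
  rw [this]
  have h3 : Real.sqrt (Real.pi^3/4) ≤ 3 := by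
    rw [Real.sqrt_le_left (by norm_num)]
    have := Real.pi_lt_d2
    calc Real.pi^3/4 ≤ 3.15^3/4 := by gcongr
      _ ≤ 3^2 := by norm_num
  rw [← add_div, ← add_div]
  gcongr
  linarith

lemma phiF_sq {d : ℕ} (hd : 0 < d) (n : ℕ) (θ : Fin d → ℝ) :
    |phiF θ|^(2*n) ≤ ∏ j, Real.exp (-((n:ℝ)/d) * Real.sin (θ j)^2) := by
  have hd' : (0:ℝ) < d := by exact_mod_cast hd
  have h1 : phiF θ ^2 ≤ Real.exp (-(∑ j, Real.sin (θ j)^2)/d) := by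
    have : phiF θ ^2 ≤ (∑ j, Real.cos (θ j)^2) / d := by
      unfold phiF
      have := sq_sum_le_card_mul_sum_sq (s := (Finset.univ : Finset (Fin d))) (f := fun j => Real.cos (θ j))
      rw [div_pow, div_le_div_iff₀ (by positivity) (by positivity)]
      simp at this
      nlinarith
    have h2 : (∑ j, Real.cos (θ j)^2) / d = -(∑ j, Real.sin (θ j)^2)/d + 1 := by
      field_simp
      rw [← sub_eq_iff_eq_add', sub_neg_eq_add, ← Finset.sum_add_distrib]
      simp
    exact (this.trans_eq h2).trans (Real.add_one_le_exp _)
  rw [pow_mul, sq_abs, ← Real.exp_sum]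
  calc (phiF θ ^2)^n ≤ (Real.exp (-(∑ j, Real.sin (θ j)^2)/d))^n := by gcongr
    _ = _ := by
      rw [← Real.exp_nat_mul, ← Finset.mul_sum]; congr 1; ring

lemma stepP_even {d : ℕ} (hd : 0 < d) (n : ℕ) (hn : 0 < n) (x y : Zd d) :
    stepP d (2*n) x y ≤ (10 / Real.sqrt ((n:ℝ)/d)) ^ d := by
  have hd' : (0:ℝ) < d := by exact_mod_cast hd
  have hn' : (0:ℝ) < n := by exact_mod_cast hn
  have h := congrArg norm (stepP_fourier hd (2*n) x y)
  have h1 : stepP d (2*n) x y ≤ ‖(2 * Real.pi : ℂ)^d * stepP d (2*n) x y‖ := by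
    rw [norm_mul, Complex.norm_real, Real.norm_of_nonneg (stepP_nonneg _ _ _ _), norm_pow]
    have : (1:ℝ) ≤ ‖(2 * Real.pi : ℂ)‖ ^ d := by
      apply one_le_pow₀
      simp [abs_of_pos Real.pi_pos]
      linarith [Real.pi_gt_three]
    nlinarith [stepP_nonneg d (2*n) x y]
  refine h1.trans ?_
  rw [← h]
  refine (norm_integral_le_integral_norm _).trans ?_
  calc ∫ θ, ‖((phiF θ : ℂ))^(2*n) * charF (x - y) θ‖ ∂(Measure.pi fun _ : Fin d => angM)
      ≤ ∫ θ, ∏ j, Real.exp (-((n:ℝ)/d) * Real.sin (θ j)^2) ∂(Measure.pi fun _ : Fin d => angM) := by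
        apply integral_mono (four_int _ _).norm
        · refine Integrable.of_bound (C := 1) ?_ ?_
          · apply Continuous.aestronglyMeasurable; fun_prop
          · refine Filter.Eventually.of_forall fun θ => ?_
            rw [Real.norm_eq_abs, abs_of_nonneg (Finset.prod_nonneg fun j _ => (Real.exp_pos _).le)]
            apply Finset.prod_le_one (fun j _ => (Real.exp_pos _).le)
            intro j _
            rw [Real.exp_le_one_iff]
            have : 0 ≤ (n:ℝ)/d * Real.sin (θ j)^2 := by positivity
            linarith
        · intro θ
          simp only [norm_mul, charF_norm, mul_one, norm_pow, Complex.norm_real]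
          exact phiF_sq hd n θ
    _ = ∏ j : Fin d, ∫ t, Real.exp (-((n:ℝ)/d) * Real.sin t^2) ∂angM := by
        rw [MeasureTheory.integral_fintype_prod_eq_prod (f := fun _ t => Real.exp (-((n:ℝ)/d) * Real.sin t^2))]
    _ ≤ ∏ j : Fin d, (10 / Real.sqrt ((n:ℝ)/d)) := by
        apply Finset.prod_le_prod
        · intro j _; exact integral_nonneg fun t => (Real.exp_pos _).le
        · intro j _; exact sin_sq_bound _ (by positivity)
    _ = _ := by rw [Finset.prod_const, Finset.card_univ, Fintype.card_fin]

lemma stepP_le_one {d : ℕ} (hd : 0 < d) (n : ℕ) (x y : Zd d) : stepP d n x y ≤ 1 := by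
  have hd' : (0:ℝ) < d := by exact_mod_cast hd
  induction n generalizing x with
  | zero => simp only [stepP]; split_ifs <;> norm_num
  | succ n ih =>
    rw [stepP_succ, div_le_one (by positivity)]
    refine (Finset.sum_le_sum fun b _ => ih _).trans ?_
    simp [mul_comm]

/-- Heat kernel bound. -/
lemma heat_kernel {d : ℕ} (hd : 0 < d) :
    ∃ C : ℝ, 0 < C ∧ ∀ n x y, stepP d n x y ≤ C * (1 / Real.sqrt (n+1)) ^ d := by
  have hd' : (0:ℝ) < d := by exact_mod_cast hd
  have heven : ∀ n : ℕ, ∀ x y, stepP d (2*n) x y ≤ (10 * Real.sqrt (4*d)) ^ d * (1/Real.sqrt ((2*n+1 : ℕ)+1))^d := by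
    intro n x y
    rcases Nat.eq_zero_or_pos n with h | h
    · subst h
      refine (stepP_le_one hd _ _ _).trans ?_
      rw [← mul_pow]
      apply one_le_pow₀
      rw [mul_one_div, le_div_iff₀ (by positivity), one_mul]
      have h1 : Real.sqrt ((2*0+1:ℕ)+1) ≤ Real.sqrt (4*d) := by
        apply Real.sqrt_le_sqrt
        have : (1:ℝ) ≤ d := by exact_mod_cast hd
        push_cast; linarith
      nlinarith [Real.sqrt_nonneg (4*d : ℝ)]
    · refine (stepP_even hd n h x y).trans ?_
      have hn : (1:ℝ) ≤ n := by exact_mod_cast h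
      rw [← mul_pow]
      gcongr
      rw [mul_one_div, mul_div_assoc, div_eq_mul_inv]
      gcongr
      rw [← Real.sqrt_div (by positivity), ← Real.sqrt_inv]
      apply Real.sqrt_le_sqrt
      push_cast
      rw [inv_div, div_le_div_iff₀ (by positivity) (by positivity)]
      nlinarith
  refine ⟨(10 * Real.sqrt (4*d)) ^ d, by positivity, fun n x y => ?_⟩
  rcases Nat.even_or_odd' n with ⟨k, rfl | rfl⟩
  · refine (heven k x y).trans ?_
    gcongr
    linarith
  · rw [stepP_succ, div_le_iff₀ (by positivity)]
    refine (Finset.sum_le_sum fun b _ => heven k _ y).trans ?_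
    simp only [Finset.sum_const, Finset.card_univ, Fintype.card_prod, Fintype.card_fin, Fintype.card_bool, nsmul_eq_mul]
    push_cast
    exact le_of_eq (by ring)

open MeasureTheory ProbabilityTheory
open scoped ENNReal NNReal

/-- `1 / √(m+1)` -/
noncomputable def rr (m : ℕ) : ℝ := 1 / Real.sqrt (m+1)

lemma rr_pos (m : ℕ) : 0 < rr m := by unfold rr; positivity

lemma rr_anti {m n : ℕ} (h : m ≤ n) : rr n ≤ rr m := by
  unfold rr
  have : (m:ℝ) ≤ n := by exact_mod_cast h
  gcongr

lemma rr_le_one (m : ℕ) : rr m ≤ 1 := by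
  have := rr_anti (Nat.zero_le m)
  simpa [rr] using this

lemma rr_tel (l : ℕ) : rr l ^ 3 ≤ 4 * (rr l - rr (l+1)) := by
  unfold rr
  set a := Real.sqrt ((l:ℝ)+1) with ha
  set b := Real.sqrt (((l+1:ℕ):ℝ)+1) with hb
  have ha0 : 0 < a := by positivity
  have hb0 : 0 < b := by positivity
  have ha2 : a^2 = l+1 := Real.sq_sqrt (by positivity)
  have hb2 : b^2 = l+2 := by rw [hb, Real.sq_sqrt (by positivity)]; push_cast; ring
  have hl : (0:ℝ) ≤ l := by positivity
  have hab : (b-a)*(a+b) = 1 := by nlinarith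
  have h1 : 1/a - 1/b = 1/(a*b*(a+b)) := by
    field_simp; linarith
  rw [h1, div_pow, one_pow, mul_one_div, div_le_div_iff₀ (by positivity) (by positivity)]
  have h2 : b*(a+b) ≤ 4*a^2 := by nlinarith [sq_nonneg (a-b)]
  nlinarith

/-- tail of the Green function -/
noncomputable def Mt (d m : ℕ) (x y : Zd d) : ℝ := ∑' l : ℕ, stepP d (l+m) x y

lemma stepP_tail {d : ℕ} (hd : 3 ≤ d) {C : ℝ} (hC : 0 < C)
    (h : ∀ n x y, stepP d n x y ≤ C * (1 / Real.sqrt (n+1)) ^ d) (m : ℕ) (x y : Zd d) (k : ℕ) :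
    ∑ l ∈ Finset.range k, stepP d (l+m) x y ≤ 4 * C * rr m ^ (d-2) := by
  have h1 : ∀ l, stepP d (l+m) x y ≤ 4 * C * rr m ^(d-3) * (rr (l+m) - rr (l+1+m)) := by
    intro l
    refine (h _ _ _).trans ?_
    have e : (1 / Real.sqrt (((l+m:ℕ):ℝ)+1)) = rr (l+m) := rfl
    rw [e, show d = (d-3)+3 by omega, pow_add]
    have h2 : rr (l+m)^(d-3) ≤ rr m ^(d-3) :=
      pow_le_pow_left₀ (rr_pos _).le (rr_anti (by omega)) _
    have h3 := rr_tel (l+m)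
    have h4 : rr (l+m)^(d-3) * rr (l+m)^3 ≤ rr m ^(d-3) * (4 * (rr (l+m) - rr (l+m+1))) :=
      mul_le_mul h2 h3 (by have := rr_pos (l+m); positivity) (by have := rr_pos m; positivity)
    rw [show l + 1 + m = l+m+1 by ring, show d - 3 + 3 - 3 = d - 3 by omega]
    nlinarith
  refine (Finset.sum_le_sum fun l _ => h1 l).trans ?_
  rw [← Finset.mul_sum, Finset.sum_range_sub' (fun l => rr (l+m)), zero_add,
    show d - 2 = (d-3)+1 by omega, pow_succ, ← mul_assoc]
  have := rr_pos (k+m)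
  have h5 := rr_pos m
  gcongr
  linarith

/-- Uniform tail bound. -/
structure TailBd (d : ℕ) (C : ℝ) : Prop where
  hd : 3 ≤ d
  hC : 0 < C
  summ : ∀ m x y, Summable fun l => stepP d (l+m) x y
  bd : ∀ m x y, Mt d m x y ≤ C * rr m ^ (d-2)

lemma exists_tailBd {d : ℕ} (hd : 3 ≤ d) : ∃ C, TailBd d C := by
  obtain ⟨C, hC, h⟩ := heat_kernel (d := d) (by omega)
  refine ⟨4*C, hd, by positivity, fun m x y => ?_, fun m x y => ?_⟩
  · exact summable_of_sum_range_le (fun l => stepP_nonneg _ _ _ _) (stepP_tail hd hC h m x y)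
  · exact Real.tsum_le_of_sum_range_le (fun l => stepP_nonneg _ _ _ _) (stepP_tail hd hC h m x y)

lemma Mt_nonneg (d m : ℕ) (x y : Zd d) : 0 ≤ Mt d m x y := tsum_nonneg fun _ => stepP_nonneg _ _ _ _

lemma green_eq_Mt (d : ℕ) (x y : Zd d) : green d x y = Mt d 0 x y := rfl

lemma green_nonneg (d : ℕ) (x y : Zd d) : 0 ≤ green d x y := Mt_nonneg d 0 x y

lemma green_symm (d : ℕ) (x y : Zd d) : green d x y = green d y x := by
  unfold green; simp only [stepP_symm d _ x y]

lemma green_self {d : ℕ} {C : ℝ} (h : TailBd d C) (x : Zd d) : 1 ≤ green d x x := by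
  have := (h.summ 0 x x).le_tsum 0 (fun l _ => stepP_nonneg _ _ _ _)
  simpa [stepP, green] using this

lemma Mt_left {d : ℕ} {C : ℝ} (h : TailBd d C) (m : ℕ) (x y : Zd d) :
    (∑ b : Fin d × Bool, Mt d m (x + stepVec b) y) = (2*d) * Mt d (m+1) x y := by
  have hd' : (0:ℝ) < d := by exact_mod_cast (by have := h.hd; omega)
  unfold Mt
  rw [← Summable.tsum_finsetSum (fun b _ => h.summ m _ y), ← tsum_mul_left]
  congr 1; funext l
  rw [← add_assoc, stepP_succ]; field_simp

lemma Mt_right {d : ℕ} {C : ℝ} (h : TailBd d C) (m : ℕ) (x y : Zd d) :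
    (∑ b : Fin d × Bool, Mt d m x (y + stepVec b)) = (2*d) * Mt d (m+1) x y := by
  have hd' : (0:ℝ) < d := by exact_mod_cast (by have := h.hd; omega)
  unfold Mt
  rw [← Summable.tsum_finsetSum (fun b _ => h.summ m x _), ← tsum_mul_left]
  congr 1; funext l
  rw [← add_assoc, stepP_succ_right]; field_simp

/-! ### Joint walks -/

/-- prepend a state to a path -/
def consP {V : Type} (x : V) (w : ℕ → V) : ℕ → V
  | 0 => x
  | k+1 => w k

/-- joint increments -/
def incr {d n : ℕ} (b : Fin n → Fin d × Bool) : Fin n → Zd d := fun i => stepVec (b i)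

/-- expectation over the joint walk of `T` steps started at `x` -/
noncomputable def EE {d n : ℕ} : ℕ → (Fin n → Zd d) → ((ℕ → Fin n → Zd d) → ℝ) → ℝ
  | 0, x, F => F (fun _ => x)
  | T+1, x, F => (∑ b : Fin n → Fin d × Bool, EE T (x + incr b) (fun w => F (consP x w)))
      / (2 * d : ℝ)^n

lemma card_B (d n : ℕ) : (Fintype.card (Fin n → Fin d × Bool) : ℝ) = (2 * d : ℝ)^n := by
  simp [mul_comm]

section
variable {d n : ℕ}

lemma EE_mono (T : ℕ) (x : Fin n → Zd d) (F G : (ℕ → Fin n → Zd d) → ℝ)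
    (h : ∀ w, w 0 = x → F w ≤ G w) : EE T x F ≤ EE T x G := by
  induction T generalizing x F G with
  | zero => exact h _ rfl
  | succ T ih =>
    unfold EE
    gcongr with b
    exact ih _ _ _ fun w _ => h _ rfl

lemma EE_congr (T : ℕ) (x : Fin n → Zd d) (F G : (ℕ → Fin n → Zd d) → ℝ)
    (h : ∀ w, w 0 = x → F w = G w) : EE T x F = EE T x G :=
  le_antisymm (EE_mono T x F G fun w hw => (h w hw).le) (EE_mono T x G F fun w hw => (h w hw).ge)

lemma EE_const (hd : 0 < d) (T : ℕ) (x : Fin n → Zd d) (c : ℝ) : EE T x (fun _ => c) = c := by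
  have hd' : (0:ℝ) < d := by exact_mod_cast hd
  induction T generalizing x with
  | zero => rfl
  | succ T ih =>
    unfold EE
    simp only [ih]
    rw [Finset.sum_const, nsmul_eq_mul, Finset.card_univ, card_B]
    field_simp

lemma EE_mul (T : ℕ) (x : Fin n → Zd d) (c : ℝ) (F : (ℕ → Fin n → Zd d) → ℝ) :
    EE T x (fun w => c * F w) = c * EE T x F := by
  induction T generalizing x F with
  | zero => rfl
  | succ T ih =>
    unfold EE
    simp only [ih (F := fun w => F (consP x w))]
    rw [← Finset.mul_sum, mul_div_assoc]

lemma EE_sum {ι : Type} (s : Finset ι) (T : ℕ) (x : Fin n → Zd d)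
    (F : ι → (ℕ → Fin n → Zd d) → ℝ) :
    EE T x (fun w => ∑ a ∈ s, F a w) = ∑ a ∈ s, EE T x (F a) := by
  induction T generalizing x F with
  | zero => rfl
  | succ T ih =>
    unfold EE
    simp only [ih (F := fun a w => F a (consP x w))]
    rw [Finset.sum_comm, Finset.sum_div]

/-- Markov property, as an inequality. -/
lemma EE_markov (a b : ℕ) (x : Fin n → Zd d) (F G H : (ℕ → Fin n → Zd d) → ℝ) (η : ℝ)
    (hG0 : ∀ w, 0 ≤ G w)
    (hG : ∀ w w', (∀ t ≤ a, w t = w' t) → G w = G w')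
    (hF : ∀ w, F w ≤ G w * H (fun t => w (a + t)))
    (hH : ∀ y, EE b y H ≤ η) : EE (a+b) x F ≤ η * EE a x G := by
  induction a generalizing x F G with
  | zero =>
    calc EE (0+b) x F ≤ EE (0+b) x (fun w => G (fun _ => x) * H w) := by
          refine EE_mono _ _ _ _ fun w hw => ?_
          refine (hF w).trans (le_of_eq ?_)
          simp only [zero_add]
          congr 1
          apply hG
          intro t ht
          obtain rfl : t = 0 := by omega
          exact hw
      _ = G (fun _ => x) * EE b x H := by rw [EE_mul, zero_add]
      _ ≤ η * EE 0 x G := by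
          rw [mul_comm η]
          exact mul_le_mul_of_nonneg_left (hH x) (hG0 _)
  | succ a ih =>
    rw [Nat.add_right_comm]
    unfold EE
    rw [← mul_div_assoc, Finset.mul_sum]
    gcongr with c
    apply ih
    · intro w; exact hG0 _
    · intro w w' h
      apply hG
      intro t ht
      cases t with
      | zero => rfl
      | succ t => exact h t (by omega)
    · intro w
      refine (hF _).trans (le_of_eq ?_)
      congr 2
      funext t
      rw [Nat.add_right_comm]
      rfl

lemma sum_update (i : Fin n) (F : (Fin n → Fin d × Bool) → ℝ) :
    ∑ b, ∑ p, F (Function.update b i p) = (2*d) * ∑ b, F b := by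
  have e : Function.Involutive (fun q : (Fin n → Fin d × Bool) × (Fin d × Bool) =>
      (Function.update q.1 i q.2, q.1 i)) := by
    intro q; simp
  rw [← Fintype.sum_prod_type' (f := fun b p => F (Function.update b i p)),
    Fintype.sum_equiv e.toPerm (fun q => F (Function.update q.1 i q.2)) (fun q => F q.1)
      (fun q => rfl), Fintype.sum_prod_type]
  simp [Finset.mul_sum, mul_comm]

lemma avg_right {C : ℝ} (h : TailBd d C) (m : ℕ) (c : Zd d) (x : Fin n → Zd d) (j : Fin n) :
    (∑ b : Fin n → Fin d × Bool, Mt d m c ((x + incr b) j)) / (2*d:ℝ)^n = Mt d (m+1) c (x j) := by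
  have hd' : (0:ℝ) < d := by exact_mod_cast (by have := h.hd; omega)
  have := sum_update j (fun b : Fin n → Fin d × Bool => Mt d m c ((x + incr b) j))
  simp only [Pi.add_apply, incr, Function.update_self, Mt_right h] at this ⊢
  rw [Finset.sum_const, nsmul_eq_mul, Finset.card_univ, card_B] at this
  rw [div_eq_iff (by positivity)]
  have h2 : (2*d:ℝ) ≠ 0 := by positivity
  apply mul_left_cancel₀ h2
  rw [← this]; ring

lemma avg_left {C : ℝ} (h : TailBd d C) (m : ℕ) (x : Fin n → Zd d) (i j : Fin n)
    (hij : i ≠ j) :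
    (∑ b : Fin n → Fin d × Bool, Mt d m ((x + incr b) i) ((x + incr b) j)) / (2*d:ℝ)^n
      = Mt d (m+2) (x i) (x j) := by
  have hd' : (0:ℝ) < d := by exact_mod_cast (by have := h.hd; omega)
  have := sum_update i (fun b : Fin n → Fin d × Bool => Mt d m ((x + incr b) i) ((x + incr b) j))
  simp only [Pi.add_apply, incr, Function.update_self, Function.update_of_ne hij.symm,
    Mt_left h] at this
  have h3 := avg_right h (m+1) (x i) x j
  rw [← h3]
  congr 1
  simp only [Pi.add_apply, incr]
  have h2 : (2*d:ℝ) ≠ 0 := by positivity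
  apply mul_left_cancel₀ h2
  rw [← this, Finset.mul_sum]

lemma EE_right {C : ℝ} (h : TailBd d C) (m t T : ℕ) (ht : t ≤ T) (c : Zd d) (x : Fin n → Zd d)
    (j : Fin n) : EE T x (fun w => Mt d m c (w t j)) = Mt d (m+t) c (x j) := by
  induction t generalizing T x with
  | zero =>
    rw [EE_congr T x _ (fun _ => Mt d m c (x j)) (fun w hw => by rw [hw]),
      EE_const (by have := h.hd; omega)]; rfl
  | succ t ih =>
    obtain ⟨T, rfl⟩ : ∃ T', T = T'+1 := ⟨T-1, by omega⟩
    unfold EE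
    simp only [consP]
    rw [← add_assoc, ← avg_right h]
    congr 1
    refine Finset.sum_congr rfl fun b _ => ?_
    exact ih T (by omega) _

lemma EE_off {C : ℝ} (h : TailBd d C) (s t T : ℕ) (hst : s ≤ t) (ht : t ≤ T) (x : Fin n → Zd d)
    (i j : Fin n) (hij : i ≠ j) :
    EE T x (fun w => green d (w s i) (w t j)) = Mt d (s+t) (x i) (x j) := by
  induction s generalizing t T x with
  | zero =>
    have := EE_right h 0 t T ht (x i) x j
    rw [← this]
    exact EE_congr T x _ _ (fun w hw => by rw [hw]; rfl)
  | succ s ih =>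
    obtain ⟨T, rfl⟩ : ∃ T', T = T'+1 := ⟨T-1, by omega⟩
    obtain ⟨t, rfl⟩ : ∃ t', t = t'+1 := ⟨t-1, by omega⟩
    unfold EE
    simp only [consP]
    rw [show s+1+(t+1) = s+t+2 by ring, ← avg_left h _ _ _ _ hij]
    congr 1
    refine Finset.sum_congr rfl fun b _ => ?_
    exact ih t T (by omega) (by omega) _

lemma EE_diag {C : ℝ} (h : TailBd d C) (s t T : ℕ) (hst : s ≤ t) (ht : t ≤ T) (x : Fin n → Zd d)
    (i : Fin n) :
    EE T x (fun w => green d (w s i) (w t i)) ≤ C * rr (t-s)^(d-2) := by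
  have hd' : (0:ℝ) < d := by exact_mod_cast (by have := h.hd; omega)
  induction s generalizing t T x with
  | zero =>
    have := EE_right h 0 t T ht (x i) x i
    rw [EE_congr T x _ _ (fun w hw => by rw [hw]), show green d = Mt d 0 from rfl, this]
    simpa using h.bd t (x i) (x i)
  | succ s ih =>
    obtain ⟨T, rfl⟩ : ∃ T', T = T'+1 := ⟨T-1, by omega⟩
    obtain ⟨t, rfl⟩ : ∃ t', t = t'+1 := ⟨t-1, by omega⟩
    unfold EE
    simp only [consP]
    rw [div_le_iff₀ (by positivity), show t+1-(s+1) = t-s by omega]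
    refine (Finset.sum_le_sum fun b _ => ih t T (by omega) (by omega) _).trans ?_
    rw [Finset.sum_const, nsmul_eq_mul, Finset.card_univ, card_B, mul_comm]
end

open MeasureTheory ProbabilityTheory
open scoped ENNReal NNReal

/-- the set of energies in the definition of capacity -/
def enSet (d : ℕ) (K : Set (Zd d)) : Set ℝ :=
  {E : ℝ | ∃ (s : Finset (Zd d)) (ν : Zd d → ℝ), ↑s ⊆ K ∧
    (∀ z, 0 ≤ ν z) ∧ (∀ z ∉ s, ν z = 0) ∧ (∑ z ∈ s, ν z) = 1 ∧ E = energy d s ν}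

lemma capacity_eq (d : ℕ) (K : Set (Zd d)) : capacity d K = (sInf (enSet d K))⁻¹ := rfl

lemma enSet_mono {d : ℕ} {K K' : Set (Zd d)} (h : K ⊆ K') : enSet d K ⊆ enSet d K' := by
  rintro E ⟨s, ν, h1, h2⟩
  exact ⟨s, ν, h1.trans h, h2⟩

lemma enSet_lower {d : ℕ} {C : ℝ} (h : TailBd d C) {K : Set (Zd d)} (hK : K.Finite) :
    ∀ E ∈ enSet d K, 1 / (K.ncard + 1 : ℝ) ≤ E := by
  rintro E ⟨s, ν, hs, h0, -, h1, rfl⟩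
  have e1 : ∑ z ∈ s, ν z ^ 2 ≤ energy d s ν := by
    unfold energy
    refine Finset.sum_le_sum fun z hz => ?_
    refine le_trans ?_ (Finset.single_le_sum (f := fun w => green d z w * ν z * ν w)
      (fun w _ => mul_nonneg (mul_nonneg (green_nonneg _ _ _) (h0 _)) (h0 _)) hz)
    have := green_self h z
    nlinarith [mul_nonneg (h0 z) (h0 z)]
  refine le_trans ?_ e1
  have e2 := sq_sum_le_card_mul_sum_sq (s := s) (f := ν)
  rw [h1, one_pow] at e2
  have e3 : (s.card : ℝ) ≤ K.ncard + 1 := by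
    have := Set.ncard_le_ncard hs hK
    rw [Set.ncard_coe_finset] at this
    have : (s.card : ℝ) ≤ K.ncard := by exact_mod_cast this
    linarith
  rw [div_le_iff₀ (by positivity)]
  have e4 : 0 ≤ ∑ z ∈ s, ν z ^ 2 := Finset.sum_nonneg fun z _ => sq_nonneg _
  nlinarith

lemma enSet_bdd {d : ℕ} {C : ℝ} (h : TailBd d C) {K : Set (Zd d)} (hK : K.Finite) :
    BddBelow (enSet d K) := ⟨_, fun E hE => enSet_lower h hK E hE⟩

lemma cap_ge {d : ℕ} {C : ℝ} (h : TailBd d C) {K : Set (Zd d)} (hK : K.Finite) {E : ℝ}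
    (hE : E ∈ enSet d K) : E⁻¹ ≤ capacity d K := by
  rw [capacity_eq]
  apply inv_anti₀
  · refine lt_of_lt_of_le ?_ (le_csInf ⟨E, hE⟩ (enSet_lower h hK))
    positivity
  · exact csInf_le (enSet_bdd h hK) hE

lemma cap_nonneg {d : ℕ} (K : Set (Zd d)) : 0 ≤ capacity d K := by
  rw [capacity_eq]
  apply inv_nonneg.2
  apply Real.sInf_nonneg
  rintro E ⟨s, ν, hs, h0, -, h1, rfl⟩
  exact Finset.sum_nonneg fun z _ => Finset.sum_nonneg fun w _ =>
    mul_nonneg (mul_nonneg (green_nonneg _ _ _) (h0 _)) (h0 _)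

lemma enSet_point {d : ℕ} {K : Set (Zd d)} {z : Zd d} (hz : z ∈ K) :
    green d z z ∈ enSet d K := by
  classical
  refine ⟨{z}, fun w => if w = z then 1 else 0, by simpa using hz, ?_, ?_, ?_, ?_⟩
  · intro w; dsimp; split_ifs <;> norm_num
  · intro w hw; simpa using hw
  · simp
  · simp [energy]

lemma cap_pos {d : ℕ} {C : ℝ} (h : TailBd d C) {K : Set (Zd d)} (hK : K.Finite)
    (hne : K.Nonempty) : 0 < capacity d K := by
  obtain ⟨z, hz⟩ := hne
  refine lt_of_lt_of_le ?_ (cap_ge h hK (enSet_point hz))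
  have := green_self h z
  positivity

lemma cap_mono {d : ℕ} {C : ℝ} (h : TailBd d C) {K K' : Set (Zd d)} (hK' : K'.Finite)
    (hs : K ⊆ K') : capacity d K ≤ capacity d K' := by
  rcases K.eq_empty_or_nonempty with he | ⟨z, hz⟩
  · have : enSet d K = ∅ := by
      rw [Set.eq_empty_iff_forall_notMem]
      rintro E ⟨s, ν, hs, h0, -, h1, rfl⟩
      rw [he, Set.subset_empty_iff, Finset.coe_eq_empty] at hs
      simp [hs] at h1
    rw [capacity_eq, this, Real.sInf_empty, inv_zero]
    exact cap_nonneg _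
  · rw [capacity_eq, capacity_eq]
    apply inv_anti₀
    · refine lt_of_lt_of_le ?_ (le_csInf ⟨_, enSet_point (hs hz)⟩ (enSet_lower h hK'))
      positivity
    · exact csInf_le_csInf (enSet_bdd h hK') ⟨_, enSet_point hz⟩ (enSet_mono hs)

lemma cap_family {d : ℕ} {C : ℝ} (h : TailBd d C) {K : Set (Zd d)} (hK : K.Finite)
    {ι : Type} [Fintype ι] [Nonempty ι] (p : ι → Zd d) (hp : ∀ a, p a ∈ K) :
    ((∑ a, ∑ b, green d (p a) (p b)) / (Fintype.card ι : ℝ)^2)⁻¹ ≤ capacity d K := by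
  classical
  apply cap_ge h hK
  have hc : (0:ℝ) < Fintype.card ι := by exact_mod_cast Fintype.card_pos
  have key : ∀ f : Zd d → ℝ, ∑ z ∈ Finset.univ.image p,
      f z * ((∑ a, if p a = z then (1:ℝ) else 0) / Fintype.card ι) =
      (∑ a, f (p a)) / Fintype.card ι := by
    intro f
    simp only [← mul_div_assoc]
    rw [← Finset.sum_div]
    congr 1
    simp only [Finset.mul_sum]
    rw [Finset.sum_comm]
    refine Finset.sum_congr rfl fun a _ => ?_
    rw [Finset.sum_eq_single (p a)]
    · simp
    · intro z _ hz; simp [hz.symm]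
    · intro hz; exact absurd (Finset.mem_image_of_mem _ (Finset.mem_univ a)) hz
  refine ⟨Finset.univ.image p, fun z => (∑ a, if p a = z then (1:ℝ) else 0) / Fintype.card ι,
    ?_, ?_, ?_, ?_, ?_⟩
  · intro z hz
    simp only [Finset.coe_image, Finset.coe_univ, Set.image_univ, Set.mem_range] at hz
    obtain ⟨a, rfl⟩ := hz
    exact hp a
  · intro z
    refine div_nonneg (Finset.sum_nonneg fun a _ => ?_) hc.le
    split_ifs <;> norm_num
  · intro z hz
    have : ∀ a, p a ≠ z := fun a ha => hz (ha ▸ Finset.mem_image_of_mem _ (Finset.mem_univ a))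
    simp [this]
  · have := key (fun _ => 1)
    simp only [one_mul] at this
    rw [this]
    simp [hc.ne']
  · unfold energy
    simp only [key]
    have : ∀ z, (∑ a, green d z (p a) * ((∑ a, if p a = z then (1:ℝ) else 0) / Fintype.card ι)) / Fintype.card ι = ((∑ a, green d z (p a))/ Fintype.card ι) * ((∑ a, if p a = z then (1:ℝ) else 0) / Fintype.card ι) := by
      intro z
      rw [← Finset.sum_mul]; ring
    rw [Finset.sum_congr rfl fun z _ => this z, key, ← Finset.sum_div, div_div, sq]

/-- points visited at times `1..T` -/
def rangeSet {d n : ℕ} (T : ℕ) (w : ℕ → Fin n → Zd d) : Set (Zd d) :=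
  {z | ∃ i : Fin n, ∃ t, 1 ≤ t ∧ t ≤ T ∧ w t i = z}

lemma rangeSet_finite {d n : ℕ} (T : ℕ) (w : ℕ → Fin n → Zd d) : (rangeSet T w).Finite := by
  have : rangeSet T w ⊆ (fun q : Fin n × ℕ => w q.2 q.1) '' (Set.univ ×ˢ Set.Icc 1 T) := by
    rintro z ⟨i, t, h1, h2, rfl⟩
    exact ⟨(i, t), ⟨trivial, h1, h2⟩, rfl⟩
  exact ((Set.finite_univ.prod (Set.finite_Icc 1 T)).image _).subset this

open Classical in
/-- indicator of small capacity -/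
noncomputable def badI {d n : ℕ} (θ : ℝ) (T : ℕ) (w : ℕ → Fin n → Zd d) : ℝ :=
  if capacity d (rangeSet T w) < θ then 1 else 0

lemma badI_nonneg {d n : ℕ} (θ : ℝ) (T : ℕ) (w : ℕ → Fin n → Zd d) : 0 ≤ badI θ T w := by
  unfold badI; split_ifs <;> norm_num

lemma badI_le_one {d n : ℕ} (θ : ℝ) (T : ℕ) (w : ℕ → Fin n → Zd d) : badI θ T w ≤ 1 := by
  unfold badI; split_ifs <;> norm_num

lemma badI_congr {d n : ℕ} (θ : ℝ) (T : ℕ) (w w' : ℕ → Fin n → Zd d)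
    (h : ∀ t ≤ T, w t = w' t) : badI θ T w = badI θ T w' := by
  have : rangeSet T w = rangeSet T w' := by
    ext z
    constructor
    · rintro ⟨i, t, h1, h2, rfl⟩; exact ⟨i, t, h1, h2, by rw [h t h2]⟩
    · rintro ⟨i, t, h1, h2, rfl⟩; exact ⟨i, t, h1, h2, by rw [h t h2]⟩
  unfold badI; rw [this]

lemma badI_split {d n : ℕ} {C : ℝ} (h : TailBd d C) (θ : ℝ) (a b : ℕ) (w : ℕ → Fin n → Zd d) :
    badI θ (a+b) w ≤ badI θ a w * badI θ b (fun t => w (a+t)) := by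
  have h1 : capacity d (rangeSet a w) ≤ capacity d (rangeSet (a+b) w) := by
    apply cap_mono h (rangeSet_finite _ _)
    rintro z ⟨i, t, h1, h2, rfl⟩; exact ⟨i, t, h1, by omega, rfl⟩
  have h2 : capacity d (rangeSet b (fun t => w (a+t))) ≤ capacity d (rangeSet (a+b) w) := by
    apply cap_mono h (rangeSet_finite _ _)
    rintro z ⟨i, t, h1, h2, rfl⟩; exact ⟨i, a+t, by omega, by omega, rfl⟩
  by_cases hb : capacity d (rangeSet (a+b) w) < θ
  · simp only [badI]
    rw [if_pos hb, if_pos (h1.trans_lt hb), if_pos (h2.trans_lt hb)]; norm_num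
  · have : badI θ (a+b) w = 0 := if_neg hb
    rw [this]
    exact mul_nonneg (badI_nonneg _ _ _) (badI_nonneg _ _ _)

lemma sum_rr (L : ℕ) : ∑ k ∈ Finset.range L, rr k ≤ 2 * Real.sqrt L := by
  induction L with
  | zero => simp
  | succ L ih =>
    rw [Finset.sum_range_succ]
    have : rr L ≤ 2 * (Real.sqrt (L+1) - Real.sqrt L) := by
      unfold rr
      set a := Real.sqrt ((L:ℝ)+1)
      set b := Real.sqrt (L:ℝ)
      have ha : 0 < a := by positivity
      have ha2 : a^2 = L+1 := Real.sq_sqrt (by positivity)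
      have hb2 : b^2 = L := Real.sq_sqrt (by positivity)
      rw [div_le_iff₀ ha]
      nlinarith [sq_nonneg (a-b)]
    push_cast
    linarith

lemma sum_rr_dist (L s : ℕ) (hs : s < L) :
    ∑ t ∈ Finset.range L, rr (Nat.dist s t) ≤ 4 * Real.sqrt L := by
  have hL := sum_rr L
  obtain ⟨k, rfl⟩ : ∃ k, L = s + k := ⟨L - s, by omega⟩
  rw [Finset.sum_range_add]
  have h1 : ∑ t ∈ Finset.range s, rr (Nat.dist s t) ≤ ∑ t ∈ Finset.range (s+k), rr t := by
    rw [← Finset.sum_range_reflect]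
    refine (Finset.sum_le_sum (g := rr) fun t ht => ?_).trans
      (Finset.sum_le_sum_of_subset_of_nonneg (Finset.range_mono (by omega)) fun _ _ _ => (rr_pos _).le)
    rw [Finset.mem_range] at ht
    apply rr_anti; unfold Nat.dist; omega
  have h2 : ∑ t ∈ Finset.range k, rr (Nat.dist s (s+t)) ≤ ∑ t ∈ Finset.range (s+k), rr t := by
    refine (Finset.sum_le_sum (g := rr) fun t ht => ?_).trans
      (Finset.sum_le_sum_of_subset_of_nonneg (Finset.range_mono (by omega)) fun _ _ _ => (rr_pos _).le)
    apply rr_anti; unfold Nat.dist; omega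
  linarith

lemma EE_green_bound {d n : ℕ} {C : ℝ} (h : TailBd d C) (L : ℕ) (hL : 1 ≤ L)
    (x : Fin n → Zd d) (i j : Fin n) (s t : ℕ) (hs : s < L) (ht : t < L) :
    EE (2*L) x (fun w => green d (w (L+1+s) i) (w (L+1+t) j)) ≤
      C * (1/Real.sqrt L)^(d-2) + (if i = j then C * rr (Nat.dist s t) else 0) := by
  have hC := h.hC
  have hL' : (0:ℝ) < L := by exact_mod_cast hL
  have key : ∀ (i j : Fin n) (s t : ℕ) (hs : s < L) (ht : t < L), s ≤ t →
      EE (2*L) x (fun w => green d (w (L+1+s) i) (w (L+1+t) j)) ≤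
      C * (1/Real.sqrt L)^(d-2) + (if i = j then C * rr (Nat.dist s t) else 0) := by
    intro i j s t hs ht hst
    split_ifs with hij
    · subst hij
      refine (EE_diag h _ _ (2*L) (by omega) (by omega) x i).trans ?_
      have e : L + 1 + t - (L+1+s) = Nat.dist s t := by unfold Nat.dist; omega
      rw [e]
      have h1 : rr (Nat.dist s t)^(d-2) ≤ rr (Nat.dist s t) := by
        apply pow_le_of_le_one (rr_pos _).le (rr_le_one _)
        have := h.hd; omega
      have h2 : 0 ≤ C * (1/Real.sqrt L)^(d-2) := by positivity
      nlinarith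
    · rw [EE_off h _ _ (2*L) (by omega) (by omega) x i j hij, add_zero]
      refine (h.bd _ _ _).trans ?_
      have h3 : rr (L+1+s+(L+1+t)) ≤ 1/Real.sqrt L := by
        unfold rr
        apply one_div_le_one_div_of_le (by positivity)
        apply Real.sqrt_le_sqrt
        push_cast
        have : (0:ℝ) ≤ s := by positivity
        have : (0:ℝ) ≤ t := by positivity
        linarith
      have := rr_pos (L+1+s+(L+1+t))
      gcongr
  rcases le_total s t with hst | hst
  · exact key i j s t hs ht hst
  · have := key j i t s ht hs hst
    rw [Nat.dist_comm, if_congr (eq_comm (a := j)) rfl rfl] at this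
    refine le_trans (le_of_eq ?_) this
    exact EE_congr _ _ _ _ fun w _ => green_symm _ _ _

/-- threshold -/
noncomputable def thr (d : ℕ) (C : ℝ) (n L : ℕ) : ℝ :=
  (10 * C)⁻¹ * min (n * Real.sqrt L) (Real.sqrt L ^ (d-2))

lemma block_bound {d n : ℕ} {C : ℝ} (h : TailBd d C) (L : ℕ) (hL : 1 ≤ L) (hn : 1 ≤ n)
    (x : Fin n → Zd d) : EE (2*L) x (badI (thr d C n L) (2*L)) ≤ 1/2 := by
  have hC := h.hC
  have hL' : (0:ℝ) < L := by exact_mod_cast hL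
  have hn' : (0:ℝ) < n := by exact_mod_cast hn
  set θ := thr d C n L with hθ
  have hθ0 : 0 < θ := by
    rw [hθ]; unfold thr
    have : 0 < min (n * Real.sqrt L) (Real.sqrt L ^ (d-2)) := lt_min (by positivity) (by positivity)
    positivity
  have : Nonempty (Fin n × Fin L) := ⟨(⟨0, hn⟩, ⟨0, hL⟩)⟩
  have hbad : ∀ w : ℕ → Fin n → Zd d, badI θ (2*L) w ≤ (θ / ((n:ℝ)*L)^2) *
      ∑ a : Fin n × Fin L, ∑ b : Fin n × Fin L,
        green d (w (L+1+a.2) a.1) (w (L+1+b.2) b.1) := by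
    intro w
    have hc := cap_family h (rangeSet_finite (2*L) w)
      (fun a : Fin n × Fin L => w (L+1+a.2) a.1)
      (fun a => ⟨a.1, L+1+a.2, by omega, by have := a.2.2; omega, rfl⟩)
    have hS : 0 < ∑ a : Fin n × Fin L, ∑ b : Fin n × Fin L,
        green d (w (L+1+a.2) a.1) (w (L+1+b.2) b.1) := by
      apply Finset.sum_pos _ Finset.univ_nonempty
      intro a _
      refine lt_of_lt_of_le (by linarith [green_self h (w (L+1+a.2) a.1)])
        (Finset.single_le_sum (f := fun b : Fin n × Fin L => green d (w (L+1+a.2) a.1) (w (L+1+b.2) b.1)) (fun b _ => green_nonneg _ _ _) (Finset.mem_univ a))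
    set S := ∑ a : Fin n × Fin L, ∑ b : Fin n × Fin L,
        green d (w (L+1+a.2) a.1) (w (L+1+b.2) b.1) with hSdef
    unfold badI
    split_ifs with hb
    · have h1 := hc.trans hb.le
      simp only [Fintype.card_prod, Fintype.card_fin] at h1
      push_cast at h1
      rw [inv_div, div_le_iff₀ hS] at h1
      rw [div_mul_eq_mul_div, le_div_iff₀ (by positivity)]
      linarith
    · positivity
  refine (EE_mono _ _ _ _ fun w _ => hbad w).trans ?_
  rw [EE_mul, EE_sum]
  simp only [EE_sum]
  have hsum : ∑ a : Fin n × Fin L, ∑ b : Fin n × Fin L,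
      EE (2*L) x (fun w => green d (w (L+1+a.2) a.1) (w (L+1+b.2) b.1)) ≤
      (n*L)^2 * (C * (1/Real.sqrt L)^(d-2)) + 4 * C * n * L * Real.sqrt L := by
    calc _ ≤ ∑ a : Fin n × Fin L, ∑ b : Fin n × Fin L, (C * (1/Real.sqrt L)^(d-2)
          + (if a.1 = b.1 then C * rr (Nat.dist a.2 b.2) else 0)) := by
          refine Finset.sum_le_sum fun a _ => Finset.sum_le_sum fun b _ => ?_
          exact EE_green_bound h L hL x _ _ _ _ a.2.2 b.2.2
      _ ≤ ∑ a : Fin n × Fin L, ((n*L) * (C * (1/Real.sqrt L)^(d-2)) + C * (4 * Real.sqrt L)) := by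
          refine Finset.sum_le_sum fun a _ => ?_
          rw [Finset.sum_add_distrib]
          apply add_le_add
          · simp
          · rw [Fintype.sum_prod_type, Finset.sum_eq_single a.1]
            · simp only [if_true]
              rw [← Finset.mul_sum]
              have := sum_rr_dist L a.2 a.2.2
              rw [Finset.sum_range] at this
              gcongr
            · intro j _ hj; simp [hj.symm]
            · simp
      _ = _ := by
          simp; ring
  refine (mul_le_mul_of_nonneg_left hsum (by positivity)).trans ?_
  have hq : 0 < Real.sqrt L := by positivity
  have hq2 : Real.sqrt L * Real.sqrt L = L := Real.mul_self_sqrt hL'.le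
  have t1 : θ * (C * (1/Real.sqrt L)^(d-2)) ≤ 1/10 := by
    have : θ ≤ (10*C)⁻¹ * Real.sqrt L ^(d-2) := by
      rw [hθ]; unfold thr; gcongr; exact min_le_right _ _
    calc _ ≤ (10*C)⁻¹ * Real.sqrt L ^(d-2) * (C * (1/Real.sqrt L)^(d-2)) := by gcongr
      _ = 1/10 := by rw [one_div_pow]; field_simp
  have t2 : θ * (4 * C / (n * Real.sqrt L)) ≤ 4/10 := by
    have : θ ≤ (10*C)⁻¹ * (n * Real.sqrt L) := by
      rw [hθ]; unfold thr; gcongr; exact min_le_left _ _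
    calc _ ≤ (10*C)⁻¹ * (n * Real.sqrt L) * (4 * C / (n * Real.sqrt L)) := by gcongr
      _ = 4/10 := by field_simp
  have t3 : θ / ((n:ℝ)*L)^2 * ((n*L)^2 * (C * (1/Real.sqrt L)^(d-2)) + 4 * C * n * L * Real.sqrt L)
      = θ * (C * (1/Real.sqrt L)^(d-2)) + θ * (4 * C / (n * Real.sqrt L)) := by
    have : 4 * C / (n * Real.sqrt L) = 4 * C * n * L * Real.sqrt L / (n*L)^2 := by
      rw [div_eq_div_iff (by positivity) (by positivity)]
      linear_combination (4 * C * n^2 * L) * (- hq2)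
    rw [this]
    field_simp
  rw [t3]; linarith

lemma blocks_bound {d n : ℕ} {C : ℝ} (h : TailBd d C) (L : ℕ) (hL : 1 ≤ L) (hn : 1 ≤ n) (K : ℕ)
    (x : Fin n → Zd d) : EE (2*L*K) x (badI (thr d C n L) (2*L*K)) ≤ (1/2)^K := by
  induction K generalizing x with
  | zero => simpa [EE] using badI_le_one _ _ _
  | succ K ih =>
    rw [Nat.mul_succ, add_comm]
    refine (EE_markov (2*L) (2*L*K) x _ (badI (thr d C n L) (2*L)) (badI (thr d C n L) (2*L*K))
      ((1/2)^K) (badI_nonneg _ _) (fun w w' => badI_congr _ _ w w') (badI_split h _ _ _) ih).trans ?_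
    rw [pow_succ]
    have := block_bound h L hL hn x
    gcongr

lemma blocks_bound' {d n : ℕ} {C : ℝ} (h : TailBd d C) (L : ℕ) (hL : 1 ≤ L) (hn : 1 ≤ n)
    (K T : ℕ) (hT : 2*L*K ≤ T)
    (x : Fin n → Zd d) : EE T x (badI (thr d C n L) T) ≤ (1/2)^K := by
  obtain ⟨r, rfl⟩ := Nat.exists_eq_add_of_le hT
  refine (EE_markov (2*L*K) r x _ (badI (thr d C n L) (2*L*K)) (fun _ => 1)
      1 (badI_nonneg _ _) (fun w w' => badI_congr _ _ w w') (fun w => ?_)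
      (fun y => (EE_const (by have := h.hd; omega) _ _ _).le)).trans ?_
  · refine (badI_split h _ _ _ w).trans ?_
    exact mul_le_mul_of_nonneg_left (badI_le_one _ _ _) (badI_nonneg _ _ _)
  · rw [one_mul]; exact blocks_bound h L hL hn K x

open MeasureTheory ProbabilityTheory
open scoped ENNReal NNReal

/-- explicit joint path from increments -/
def pathOf {d n : ℕ} : (T : ℕ) → (Fin n → Zd d) → (Fin T → Fin n → Fin d × Bool) →
    ℕ → Fin n → Zd d
  | 0, x, _ => fun _ => x
  | T+1, x, s => consP x (pathOf T (x + incr (s 0)) (Fin.tail s))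

lemma pathOf_zero {d n : ℕ} (T : ℕ) (x : Fin n → Zd d) (s : Fin T → Fin n → Fin d × Bool) :
    pathOf T x s 0 = x := by
  cases T <;> rfl

lemma EE_eq {d n : ℕ} (T : ℕ) (x : Fin n → Zd d) (F : (ℕ → Fin n → Zd d) → ℝ) :
    EE T x F = (∑ s : Fin T → Fin n → Fin d × Bool, F (pathOf T x s)) / ((2 * d : ℝ)^n)^T := by
  induction T generalizing x F with
  | zero => simp [EE, pathOf]
  | succ T ih =>
    unfold EE
    simp only [ih]
    rw [← Finset.sum_div, div_div, ← pow_succ]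
    congr 1
    rw [← Fintype.sum_prod_type' (f := fun b s => F (consP x (pathOf T (x + incr b) s)))]
    refine Fintype.sum_equiv (Fin.consEquiv (fun _ : Fin (T+1) => Fin n → Fin d × Bool)) _ _ ?_
    rintro ⟨b, s⟩
    simp [pathOf, Fin.consEquiv]

lemma isStep_exists {d : ℕ} {x y : Zd d} (h : IsStep x y) : ∃ b, y = x + stepVec b := by
  unfold IsStep at h
  obtain ⟨j, hj⟩ : ∃ j, (y j - x j).natAbs ≠ 0 := by
    by_contra hc
    push Not at hc
    simp [hc] at h
  rw [← Finset.add_sum_erase _ _ (Finset.mem_univ j)] at h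
  have h1 : (y j - x j).natAbs = 1 := by omega
  have h2 : ∑ k ∈ Finset.univ.erase j, (y k - x k).natAbs = 0 := by omega
  rw [Finset.sum_eq_zero_iff] at h2
  have h3 : ∀ k, k ≠ j → y k = x k := by
    intro k hk
    have := h2 k (by simp [hk])
    omega
  rcases Int.natAbs_eq_iff.1 h1 with h4 | h4
  · refine ⟨(j, true), ?_⟩
    funext k
    by_cases hk : k = j
    · subst hk; simp [stepVec]; simp at h4; omega
    · simp [stepVec, hk, h3 k hk]
  · refine ⟨(j, false), ?_⟩
    funext k
    by_cases hk : k = j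
    · subst hk; simp [stepVec]; simp at h4; omega
    · simp [stepVec, hk, h3 k hk]

lemma exists_pathOf {d n : ℕ} (T : ℕ) (w : ℕ → Fin n → Zd d)
    (h : ∀ t < T, ∀ i, IsStep (w t i) (w (t+1) i)) :
    ∃ s, ∀ t ≤ T, pathOf T (w 0) s t = w t := by
  induction T generalizing w with
  | zero =>
    refine ⟨Fin.elim0, fun t ht => ?_⟩
    obtain rfl : t = 0 := by omega
    rfl
  | succ T ih =>
    choose b hb using fun i => isStep_exists (h 0 (by omega) i)
    obtain ⟨s, hs⟩ := ih (fun t => w (t+1)) (fun t ht i => h (t+1) (by omega) i)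
    refine ⟨Fin.cons b s, fun t ht => ?_⟩
    cases t with
    | zero => rfl
    | succ t =>
      have h1 : w 0 + incr b = w (0+1) := by
        funext i; exact (hb i).symm
      simp only [pathOf, consP, Fin.cons_zero, Fin.tail_cons, h1]
      exact hs t (by omega)

lemma escProb_nonneg (d : ℕ) (A : Set (Zd d)) (n : ℕ) (z : Zd d) : 0 ≤ escProb d A n z := by
  induction n generalizing z with
  | zero => simp [escProb]
  | succ n ih =>
    unfold escProb
    refine div_nonneg (Finset.sum_nonneg fun j _ => add_nonneg ?_ ?_) (by positivity)
    · split_ifs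
      · exact le_rfl
      · exact ih _
    · split_ifs
      · exact le_rfl
      · exact ih _

lemma neq_nonneg (d : ℕ) (A : Set (Zd d)) (z : Zd d) : 0 ≤ neqMeasure d A z := by
  unfold neqMeasure eqMeasure
  refine div_nonneg ?_ (cap_nonneg _)
  split_ifs
  · exact Real.iInf_nonneg fun n => escProb_nonneg _ _ _ _
  · exact le_rfl

lemma neq_zero (d : ℕ) (A : Set (Zd d)) (z : Zd d) (hz : z ∉ A) : neqMeasure d A z = 0 := by
  simp [neqMeasure, eqMeasure, hz]

lemma pois_nonneg {l : ℝ} (hl : 0 ≤ l) (n : ℕ) : 0 ≤ poissonProb l n := by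
  unfold poissonProb; positivity

/-- extend a family indexed by `Fin n` -/
def extW {d n : ℕ} (w : ℕ → Fin n → Zd d) (k t : ℕ) : Zd d :=
  if h : k < n then w t ⟨k, h⟩ else 0

section
variable {d : ℕ} {u : ℝ} {Ω : Type} [MeasurableSpace Ω] {P : Measure Ω} {A : Set (Zd d)}
  {N : Ω → ℕ} {Y : ℕ → ℕ → Ω → Zd d}

lemma law_path (hl : HasLevelLaw d u P A N Y) (n m : ℕ) (w : ℕ → Fin n → Zd d) :
    P {ω | N ω = n ∧ ∀ t ≤ m, ∀ k : Fin n, Y k t ω = w t k} =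
      ENNReal.ofReal (poissonProb (u * capacity d A) n *
        ∏ k : Fin n, pathProb d (neqMeasure d A) m (fun t => w t k)) := by
  have := hl.2.2 n m (extW w)
  rw [Finset.prod_range] at this
  have e : ∀ k : Fin n, extW w k = fun t => w t k := by
    intro k; funext t; simp [extW]
  simp only [e] at this
  rw [← this]
  congr 1
  ext ω
  simp only [Set.mem_ofPred_eq]
  refine and_congr_right fun _ => ⟨fun h k hk t ht => ?_, fun h t ht k => ?_⟩
  · simp [extW, hk, h t ht ⟨k, hk⟩]
  · rw [h k k.2 t ht, e]

open Classical in
lemma law_bound (hl : HasLevelLaw d u P A N Y) (hlam : 0 ≤ u * capacity d A) [Fintype A] (n T : ℕ)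
    (G : (ℕ → Fin n → Zd d) → Prop) (hG : ∀ w w', (∀ t ≤ T, w t = w' t) → (G w → G w')) :
    P {ω | N ω = n ∧ G (fun t i => Y i t ω)} ≤
      ENNReal.ofReal (poissonProb (u * capacity d A) n *
        ∑ x : Fin n → A, (∏ k, neqMeasure d A (x k)) *
          EE T (fun i => (x i : Zd d)) (fun w => if G w then 1 else 0)) := by
  -- null set
  set ext : (Fin n → Fin (T+1) → Zd d) → ℕ → Fin n → Zd d :=
    fun v t k => if h : t < T+1 then v k ⟨t, h⟩ else 0 with hext
  set nul : Set Ω := ⋃ v : {v : Fin n → Fin (T+1) → Zd d //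
      ∃ k, pathProb d (neqMeasure d A) T (fun t => ext v t k) = 0},
    {ω | N ω = n ∧ ∀ t ≤ T, ∀ k : Fin n, Y k t ω = ext v t k} with hnul
  have hnul0 : P nul = 0 := by
    rw [hnul, measure_iUnion_null_iff]
    rintro ⟨v, k, hk⟩
    rw [law_path hl, Finset.prod_eq_zero (Finset.mem_univ k) hk]
    simp
  set I := (Fin n → A) × (Fin T → Fin n → Fin d × Bool)
  set pth : I → ℕ → Fin n → Zd d := fun q => pathOf T (fun i => (q.1 i : Zd d)) q.2 with hpth
  have hcov : {ω | N ω = n ∧ G (fun t i => Y i t ω)} ⊆ nul ∪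
      ⋃ q ∈ (Finset.univ.filter fun q : I => G (pth q)),
        {ω | N ω = n ∧ ∀ t ≤ T, ∀ k : Fin n, Y k t ω = pth q t k} := by
    rintro ω ⟨hN, hg⟩
    by_cases hv : ∃ k : Fin n, pathProb d (neqMeasure d A) T (fun t => Y k t ω) = 0
    · left
      rw [hnul, Set.mem_iUnion]
      obtain ⟨k, hk⟩ := hv
      refine ⟨⟨fun k t => Y k t ω, k, ?_⟩, hN, fun t ht k => ?_⟩
      · rw [← hk]
        unfold pathProb
        have : (∀ t < T, IsStep (ext (fun k t => Y k t ω) t k) (ext (fun k t => Y k t ω) (t+1) k)) ↔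
            (∀ t < T, IsStep (Y k t ω) (Y k (t+1) ω)) := by
          refine forall₂_congr fun t ht => ?_
          simp [hext, ht, ht.le]
        simp only [this]
        simp [hext]
      · simp only [hext]
        rw [dif_pos (by omega)]
    · right
      push Not at hv
      have hst : ∀ k : Fin n, ∀ t < T, IsStep (Y k t ω) (Y k (t+1) ω) := by
        intro k
        by_contra hc
        exact hv k (if_neg hc)
      have hA : ∀ k : Fin n, Y k 0 ω ∈ A := by
        intro k
        by_contra hc
        apply hv k
        unfold pathProb
        rw [neq_zero _ _ _ hc]
        simp
      obtain ⟨s, hs⟩ := exists_pathOf T (fun t (i : Fin n) => Y i t ω) (fun t ht i => hst i t ht)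
      simp only [Set.mem_iUnion]
      refine ⟨(fun i => ⟨Y i 0 ω, hA i⟩, s), ?_, hN, ?_⟩
      · simp only [Finset.mem_filter, Finset.mem_univ, true_and]
        exact hG _ _ (fun t ht => (hs t ht).symm) hg
      · intro t ht k
        exact (congrFun (hs t ht) k).symm
  refine (measure_mono hcov).trans ((measure_union_le _ _).trans ?_)
  rw [hnul0, zero_add]
  refine (measure_biUnion_finset_le _ _).trans ?_
  have hb : ∀ q : I, P {ω | N ω = n ∧ ∀ t ≤ T, ∀ k : Fin n, Y k t ω = pth q t k} ≤
      ENNReal.ofReal (poissonProb (u * capacity d A) n *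
        ((∏ k, neqMeasure d A (q.1 k)) * (((2 * d : ℝ)^n)^T)⁻¹)) := by
    intro q
    rw [law_path hl]
    apply ENNReal.ofReal_le_ofReal
    refine mul_le_mul_of_nonneg_left ?_ (pois_nonneg hlam n)
    calc ∏ k : Fin n, pathProb d (neqMeasure d A) T (fun t => pth q t k)
        ≤ ∏ k : Fin n, (neqMeasure d A (q.1 k) * (2 * (d:ℝ))⁻¹^T) := by
          apply Finset.prod_le_prod
          · intro k _
            unfold pathProb
            split_ifs
            · exact mul_nonneg (neq_nonneg _ _ _) (by positivity)
            · exact le_rfl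
          · intro k _
            unfold pathProb
            split_ifs
            · simp only [hpth, pathOf_zero]; exact le_rfl
            · exact mul_nonneg (neq_nonneg _ _ _) (by positivity)
      _ = _ := by
          rw [Finset.prod_mul_distrib, Finset.prod_const, Finset.card_univ, Fintype.card_fin,
            inv_pow, inv_pow, ← pow_mul, ← pow_mul, mul_comm T n]
  refine (Finset.sum_le_sum fun q _ => hb q).trans ?_
  rw [← ENNReal.ofReal_sum_of_nonneg]
  · apply le_of_eq
    congr 1
    rw [Finset.sum_filter, Fintype.sum_prod_type, Finset.mul_sum]
    refine Finset.sum_congr rfl fun x _ => ?_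
    rw [EE_eq, div_eq_mul_inv, Finset.sum_mul, Finset.mul_sum, Finset.mul_sum]
    refine Finset.sum_congr rfl fun s _ => ?_
    simp only [hpth]
    split_ifs <;> simp
  · intro q _
    exact mul_nonneg (pois_nonneg hlam n)
      (mul_nonneg (Finset.prod_nonneg fun k _ => neq_nonneg _ _ _) (by positivity))

lemma mass_lower (hl : HasLevelLaw d u P A N Y) (hlam : 0 ≤ u * capacity d A) [Fintype A] (n : ℕ) :
    ENNReal.ofReal (poissonProb (u * capacity d A) n * (∑ a : A, neqMeasure d A a)^n) ≤
      P {ω | N ω = n} := by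
  have hY := hl.1
  have hN := hl.2.1
  have h1 : ∑ x : Fin n → A, P {ω | N ω = n ∧ ∀ t ≤ 0, ∀ k : Fin n, Y k t ω = (x k : Zd d)} ≤
      P {ω | N ω = n} := by
    rw [← measure_biUnion_finset]
    · apply measure_mono
      intro ω hω
      simp only [Set.mem_iUnion] at hω
      obtain ⟨x, -, h, -⟩ := hω
      exact h
    · intro x _ y _ hxy
      rw [Function.onFun, Set.disjoint_left]
      rintro ω ⟨-, h1⟩ ⟨-, h2⟩
      apply hxy
      funext k
      apply Subtype.ext
      rw [← h1 0 le_rfl k, h2 0 le_rfl k]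
    · intro x _
      have he : {ω | N ω = n ∧ ∀ t ≤ 0, ∀ k : Fin n, Y k t ω = (x k : Zd d)} =
          N ⁻¹' {n} ∩ ⋂ k : Fin n, (Y k 0) ⁻¹' {(x k : Zd d)} := by
        ext ω
        simp
      rw [he]
      exact (hN (measurableSet_singleton n)).inter
        (MeasurableSet.iInter fun k => hY k 0 (measurableSet_singleton _))
  refine le_trans (le_of_eq ?_) h1
  rw [Fintype.sum_pow, Finset.mul_sum, ENNReal.ofReal_sum_of_nonneg]
  · refine Finset.sum_congr rfl fun x _ => ?_
    rw [law_path hl n 0 (fun _ k => (x k : Zd d))]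
    simp [pathProb]
  · intro x _
    exact mul_nonneg (pois_nonneg hlam n) (Finset.prod_nonneg fun k _ => neq_nonneg _ _ _)

lemma pois_hasSum (l r : ℝ) : HasSum (fun n => poissonProb l n * r^n) (Real.exp (l * (r-1))) := by
  have := (NormedSpace.expSeries_div_hasSum_exp (𝔸 := ℝ) (l*r)).mul_left (Real.exp (-l))
  rw [← Real.exp_eq_exp_ℝ, ← Real.exp_add] at this
  have e1 : (fun n => poissonProb l n * r^n) =
      fun n : ℕ => Real.exp (-l) * ((l * r)^n / n.factorial) := by
    funext n; unfold poissonProb; rw [mul_pow]; ring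
  have e2 : l * (r - 1) = -l + l * r := by ring
  rw [e1, e2]
  exact this

lemma mass_le_one [IsProbabilityMeasure P] (hl : HasLevelLaw d u P A N Y)
    (hlam : 0 < u * capacity d A) [Fintype A] : ∑ a : A, neqMeasure d A a ≤ 1 := by
  set s := ∑ a : A, neqMeasure d A a with hs
  have hs0 : 0 ≤ s := Finset.sum_nonneg fun a _ => neq_nonneg _ _ _
  have h1 : ∀ M : ℕ, ∑ n ∈ Finset.range M, poissonProb (u * capacity d A) n * s^n ≤ 1 := by
    intro M
    rw [← ENNReal.ofReal_le_ofReal_iff zero_le_one, ENNReal.ofReal_one,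
      ENNReal.ofReal_sum_of_nonneg]
    · refine (Finset.sum_le_sum fun n _ => mass_lower hl hlam.le n).trans ?_
      rw [← measure_biUnion_finset]
      · exact prob_le_one
      · intro a _ b _ hab
        rw [Function.onFun, Set.disjoint_left]
        intro ω h1 h2
        exact hab (h1.symm.trans h2)
      · intro n _
        exact hl.2.1 (measurableSet_singleton n)
    · intro n _
      exact mul_nonneg (pois_nonneg hlam.le n) (by positivity)
  have h2 := le_of_tendsto' (pois_hasSum (u * capacity d A) s).tendsto_sum_nat h1
  rw [Real.exp_le_one_iff] at h2
  by_contra hc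
  push Not at hc
  nlinarith

end

open MeasureTheory ProbabilityTheory
open scoped ENNReal NNReal

lemma rangeSet_eq {d : ℕ} {Ω : Type} (X : ℕ → ℕ → Ω → Zd d) (n T : ℕ) (ω : Ω) :
    {z | ∃ i < n, ∃ t, 1 ≤ t ∧ t ≤ T ∧ X i t ω = z} =
      rangeSet T (fun t (i : Fin n) => X i t ω) := by
  ext z
  constructor
  · rintro ⟨i, hi, t, h⟩
    exact ⟨⟨i, hi⟩, t, h⟩
  · rintro ⟨i, t, h⟩
    exact ⟨i, i.2, t, h⟩

/-- choice of the block length -/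
lemma scale_choice (ε : ℝ) (hε : ε ∈ Set.Ioo (0:ℝ) 1) (T : ℕ) (hT : 1 ≤ T) :
    ∃ L K : ℕ, 1 ≤ L ∧ 2 * L * K ≤ T ∧ (T:ℝ) ^ ((1 - ε) / 2) ≤ √(L:ℝ) ∧
      ((1:ℝ)/2)^K ≤ 2 * Real.exp (-(1/8) * (T:ℝ)^(ε/2)) := by
  have hT0 : (1:ℝ) ≤ T := by exact_mod_cast hT
  have hTp : (0:ℝ) < T := by linarith
  have h1 : (1:ℝ) ≤ (T:ℝ)^(1-ε) := Real.one_le_rpow hT0 (by linarith [hε.2])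
  set L := ⌈(T:ℝ)^(1-ε)⌉₊ with hLdef
  have hL1 : (T:ℝ)^(1-ε) ≤ L := Nat.le_ceil _
  have hL2 : (L:ℝ) < (T:ℝ)^(1-ε) + 1 := Nat.ceil_lt_add_one (by linarith)
  have hL3 : (1:ℝ) ≤ L := h1.trans hL1
  have hL : 1 ≤ L := by exact_mod_cast hL3
  refine ⟨L, T / (2*L), hL, Nat.mul_div_le _ _, ?_, ?_⟩
  · apply Real.le_sqrt_of_sq_le
    rw [← Real.rpow_natCast, ← Real.rpow_mul hTp.le]
    refine le_trans (le_of_eq ?_) hL1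
    congr 1
    push_cast; ring
  · set K := T / (2*L) with hK
    have hK1 : (T:ℝ) < 2 * L * (K + 1) := by
      have : T < 2 * L * (K+1) := Nat.lt_mul_div_succ T (by omega)
      exact_mod_cast this
    have hprod : (T:ℝ)^ε * (T:ℝ)^(1-ε) = T := by
      rw [← Real.rpow_add hTp]; simp
    have hKe : (T:ℝ)^ε ≤ 4 * (K+1) := by
      have : (T:ℝ)^ε * (T:ℝ)^(1-ε) ≤ 4 * (K+1) * (T:ℝ)^(1-ε) := by
        rw [hprod]
        have : (2:ℝ) * L * (K+1) ≤ 2 * (2 * (T:ℝ)^(1-ε)) * (K+1) := by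
          gcongr; linarith
        linarith
      exact le_of_mul_le_mul_right this (by linarith)
    have hmono : (T:ℝ)^(ε/2) ≤ (T:ℝ)^ε :=
      Real.rpow_le_rpow_of_exponent_le hT0 (by linarith [hε.1])
    have e2 : ((1:ℝ)/2)^K = 2 * ((1:ℝ)/2)^(K+1) := by rw [pow_succ]; ring
    rw [e2]
    have e3 : (1:ℝ)/2 ≤ Real.exp (-(1/2)) := by
      have := Real.add_one_le_exp (-(1/2:ℝ))
      linarith
    have e4 : ((1:ℝ)/2)^(K+1) ≤ Real.exp (-(1/8) * (T:ℝ)^(ε/2)) := by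
      calc ((1:ℝ)/2)^(K+1) ≤ (Real.exp (-(1/2)))^(K+1) := by gcongr
        _ = Real.exp ((K+1 : ℕ) * (-(1/2))) := (Real.exp_nat_mul _ _).symm
        _ ≤ _ := by
          apply Real.exp_le_exp.2
          push_cast
          linarith
    linarith

section
variable {d : ℕ} {u : ℝ} {Ω : Type} [MeasurableSpace Ω] {P : Measure Ω} {A : Set (Zd d)}
  {N : Ω → ℕ} {X : ℕ → ℕ → Ω → Zd d}

lemma level_bound [IsProbabilityMeasure P] (hl : HasLevelLaw d u P A N X)
    (hlam : 0 < u * capacity d A) (hA : A.Finite) (n T : ℕ) (θ δ : ℝ) (hδ : 0 ≤ δ)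
    (hb : ∀ x : Fin n → Zd d, EE T x (badI θ T) ≤ δ) :
    P {ω | N ω = n ∧ capacity d {z | ∃ i < N ω, ∃ t, 1 ≤ t ∧ t ≤ T ∧ X i t ω = z} < θ} ≤
      ENNReal.ofReal (poissonProb (u * capacity d A) n * δ) := by
  classical
  have := hA.fintype
  have h1 := law_bound hl hlam.le n T (fun w => capacity d (rangeSet T w) < θ) (by
    intro w w' hw h
    have := badI_congr θ T w w' hw
    by_contra hc
    simp [badI, h, hc] at this)
  have he : {ω | N ω = n ∧ capacity d {z | ∃ i < N ω, ∃ t, 1 ≤ t ∧ t ≤ T ∧ X i t ω = z} < θ} =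
      {ω | N ω = n ∧ capacity d (rangeSet T (fun t (i : Fin n) => X i t ω)) < θ} := by
    ext ω
    simp only [Set.mem_ofPred_eq]
    refine and_congr_right fun h => ?_
    rw [h, rangeSet_eq]
  rw [he]
  refine h1.trans (ENNReal.ofReal_le_ofReal ?_)
  refine mul_le_mul_of_nonneg_left ?_ (pois_nonneg hlam.le n)
  calc _ ≤ ∑ x : Fin n → A, (∏ k, neqMeasure d A (x k)) * δ := by
        refine Finset.sum_le_sum fun x _ => mul_le_mul_of_nonneg_left ?_
          (Finset.prod_nonneg fun k _ => neq_nonneg _ _ _)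
        refine le_trans (le_of_eq ?_) (hb (fun i => x i))
        rfl
    _ = (∑ a : A, neqMeasure d A a)^n * δ := by
        rw [Fintype.sum_pow, Finset.sum_mul]
    _ ≤ 1 * δ := by
        refine mul_le_mul_of_nonneg_right (pow_le_one₀ ?_ (mass_le_one hl hlam)) hδ
        exact Finset.sum_nonneg fun k _ => neq_nonneg _ _ _
    _ = δ := one_mul _

end
/-- For `d ≥ 3`, `u > 0`, `ε ∈ (0,1)` there are `c > 0`, `C < ∞` such that for every finite
nonempty `A ⊆ ℤ^d` and every positive integer `T`: if `N` is Poisson with parameter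
`u·cap(A)` and, given `N`, `X 0, …, X (N-1)` are independent simple random walks with
starting points i.i.d. distributed as the normalized equilibrium measure of `A`, then the
set `Ψ` of points visited by these walks during times `1, …, T` satisfies
`P[cap(Ψ) ≥ c · min(cap(A) T^{(1-ε)/2}, T^{(d-2)(1-ε)/2})]
  ≥ 1 - C exp(-c · min(T^{ε/2}, cap(A)))`. -/
theorem capacity_Psi_high_prob (d : ℕ) (hd : 3 ≤ d) (u : ℝ) (hu : 0 < u)
    (ε : ℝ) (hε : ε ∈ Set.Ioo (0:ℝ) 1) :
    ∃ c C : ℝ, 0 < c ∧ 0 < C ∧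
    ∀ A : Set (Zd d), A.Finite → A.Nonempty →
    ∀ T : ℕ, 1 ≤ T →
    ∀ (Ω : Type) (_ : MeasurableSpace Ω) (P : Measure Ω), IsProbabilityMeasure P →
    ∀ (N : Ω → ℕ) (X : ℕ → ℕ → Ω → Zd d),
    HasLevelLaw d u P A N X →
    1 - ENNReal.ofReal (C * Real.exp (-c * min ((T : ℝ) ^ (ε / 2)) (capacity d A))) ≤
      P {ω | c * min (capacity d A * (T : ℝ) ^ ((1 - ε) / 2))
                     ((T : ℝ) ^ (((d : ℝ) - 2) * (1 - ε) / 2))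
          ≤ capacity d {z | ∃ i < N ω, ∃ t, 1 ≤ t ∧ t ≤ T ∧ X i t ω = z}} := by
  obtain ⟨C0, h⟩ := exists_tailBd hd
  have hC0 := h.hC
  set c : ℝ := min ((10*C0)⁻¹ * min (u/4) 1) (min (u/4) (1/8)) with hc
  have hc0 : 0 < c := by
    rw [hc]; positivity
  have hc1 : c ≤ (10*C0)⁻¹ * min (u/4) 1 := min_le_left _ _
  have hc2 : c ≤ u/4 := (min_le_right _ _).trans (min_le_left _ _)
  have hc3 : c ≤ 1/8 := (min_le_right _ _).trans (min_le_right _ _)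
  refine ⟨c, 3, hc0, by norm_num, ?_⟩
  intro A hAf hAn T hT Ω _ P hP N X hl
  obtain ⟨L, K, hL, hLK, hsq, hKb⟩ := scale_choice ε hε T hT
  have hcap : 0 < capacity d A := cap_pos h hAf hAn
  set κ := capacity d A with hκ
  have hlam : 0 < u * κ := by positivity
  set θ := c * min (κ * (T : ℝ) ^ ((1 - ε) / 2)) ((T : ℝ) ^ (((d : ℝ) - 2) * (1 - ε) / 2)) with hθ
  set lam := u * κ with hlamdef
  have hTp : (0:ℝ) < T := by exact_mod_cast hT
  have hpow : (T : ℝ) ^ (((d : ℝ) - 2) * (1 - ε) / 2) ≤ √(L:ℝ)^(d-2) := by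
    have : (T : ℝ) ^ (((d : ℝ) - 2) * (1 - ε) / 2) = ((T:ℝ)^((1-ε)/2))^(d-2) := by
      rw [← Real.rpow_natCast, ← Real.rpow_mul hTp.le]
      congr 1
      rw [Nat.cast_sub (by omega)]
      push_cast; ring
    rw [this]
    exact pow_le_pow_left₀ (by positivity) hsq _
  -- the per-level bound
  have key : ∀ n : ℕ, P {ω | N ω = n ∧
      capacity d {z | ∃ i < N ω, ∃ t, 1 ≤ t ∧ t ≤ T ∧ X i t ω = z} < θ} ≤
      ENNReal.ofReal (poissonProb lam n * ((1/2)^n * Real.exp (lam/4) + (1/2)^K)) := by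
    intro n
    apply level_bound hl hlam hAf n T θ _ (by positivity)
    intro x
    by_cases hn : (n:ℝ) < lam/4
    · have h1 : EE T x (badI θ T) ≤ 1 := by
        rw [← EE_const (by omega : 0 < d) T x 1]
        apply EE_mono
        intro w
        unfold badI
        split_ifs <;> norm_num
      have h2 : 1 ≤ ((1:ℝ)/2)^n * Real.exp (lam/4) := by
        have e3 : Real.exp (-1) ≤ 1/2 := by
          have := Real.exp_one_gt_d9
          rw [Real.exp_neg, inv_le_comm₀ (Real.exp_pos _) (by norm_num)]
          linarith
        calc (1:ℝ) ≤ Real.exp (n * (-1) + lam/4) := by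
              apply Real.one_le_exp; linarith
          _ = (Real.exp (-1))^n * Real.exp (lam/4) := by rw [Real.exp_add, Real.exp_nat_mul]
          _ ≤ _ := by gcongr
      have h3 : (0:ℝ) ≤ (1/2)^K := by positivity
      linarith
    · push Not at hn
      have hn1 : 1 ≤ n := by
        have : (0:ℝ) < n := by linarith
        exact_mod_cast this
      have hth : θ ≤ thr d C0 n L := by
        unfold thr
        have hm : min (u/4) 1 * min (κ * (T : ℝ) ^ ((1 - ε) / 2))
            ((T : ℝ) ^ (((d : ℝ) - 2) * (1 - ε) / 2)) ≤ min (n * √(L:ℝ)) (√(L:ℝ)^(d-2)) := by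
          have hp1 : 0 ≤ (T : ℝ) ^ ((1 - ε) / 2) := by positivity
          have hp2 : 0 ≤ (T : ℝ) ^ (((d : ℝ) - 2) * (1 - ε) / 2) := by positivity
          have hp3 : 0 ≤ κ * (T : ℝ) ^ ((1 - ε) / 2) := by positivity
          apply le_min
          · calc _ ≤ (u/4) * (κ * (T : ℝ) ^ ((1 - ε) / 2)) :=
                  mul_le_mul (min_le_left _ _) (min_le_left _ _) (le_min hp3 hp2) (by positivity)
              _ = (lam/4) * (T : ℝ) ^ ((1 - ε) / 2) := by rw [hlamdef]; ring
              _ ≤ n * √(L:ℝ) := mul_le_mul hn hsq hp1 (by positivity)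
          · calc _ ≤ 1 * ((T : ℝ) ^ (((d : ℝ) - 2) * (1 - ε) / 2)) :=
                  mul_le_mul (min_le_right _ _) (min_le_right _ _) (le_min hp3 hp2) (by positivity)
              _ ≤ _ := by rw [one_mul]; exact hpow
        have hle := mul_le_mul_of_nonneg_left hm (by positivity : 0 ≤ (10*C0)⁻¹)
        rw [← mul_assoc] at hle
        refine le_trans ?_ hle
        exact mul_le_mul_of_nonneg_right hc1 (by positivity)
      have h1 : EE T x (badI θ T) ≤ EE T x (badI (thr d C0 n L) T) := by
        apply EE_mono
        intro w
        unfold badI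
        split_ifs <;> first | linarith | norm_num
      have h2 := blocks_bound' h L hL hn1 K T hLK x
      have h3 : (0:ℝ) ≤ (1/2)^n * Real.exp (lam/4) := by positivity
      linarith
  -- summation
  set bad : Set Ω := {ω | capacity d {z | ∃ i < N ω, ∃ t, 1 ≤ t ∧ t ≤ T ∧ X i t ω = z} < θ} with hbad
  have hs : HasSum (fun n => poissonProb lam n * ((1/2)^n * Real.exp (lam/4) + (1/2)^K))
      (Real.exp (lam * (1/2 - 1)) * Real.exp (lam/4) + Real.exp (lam * (1-1)) * (1/2)^K) := by
    have h1 := ((pois_hasSum lam (1/2)).mul_right (Real.exp (lam/4))).add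
      ((pois_hasSum lam 1).mul_right ((1/2)^K))
    have e1 : (fun n => poissonProb lam n * ((1/2)^n * Real.exp (lam/4) + (1/2)^K)) =
        fun n => poissonProb lam n * (1/2)^n * Real.exp (lam/4) +
          poissonProb lam n * 1^n * (1/2)^K := by
      funext n
      rw [one_pow]
      ring
    rw [e1]
    exact h1
  have hPbad : P bad ≤ ENNReal.ofReal (3 * Real.exp (-c * min ((T : ℝ) ^ (ε / 2)) κ)) := by
    have hsub : bad ⊆ ⋃ n, {ω | N ω = n ∧
      capacity d {z | ∃ i < N ω, ∃ t, 1 ≤ t ∧ t ≤ T ∧ X i t ω = z} < θ} := by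
      intro ω hω
      exact Set.mem_iUnion.2 ⟨N ω, rfl, hω⟩
    refine (measure_mono hsub).trans ((measure_iUnion_le _).trans ?_)
    refine (ENNReal.tsum_le_tsum key).trans ?_
    rw [← ENNReal.ofReal_tsum_of_nonneg (fun n => mul_nonneg (pois_nonneg hlam.le n)
      (by positivity)) hs.summable, hs.tsum_eq]
    apply ENNReal.ofReal_le_ofReal
    have hm1 := min_le_left ((T : ℝ) ^ (ε / 2)) κ
    have hm2 := min_le_right ((T : ℝ) ^ (ε / 2)) κ
    have hm0 : 0 ≤ min ((T : ℝ) ^ (ε / 2)) κ := by positivity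
    have g1 : Real.exp (lam * (1/2 - 1)) * Real.exp (lam/4) ≤
        Real.exp (-c * min ((T : ℝ) ^ (ε / 2)) κ) := by
      rw [← Real.exp_add]
      apply Real.exp_le_exp.2
      have : c * min ((T : ℝ) ^ (ε / 2)) κ ≤ (u/4) * κ := mul_le_mul hc2 hm2 hm0 (by positivity)
      rw [hlamdef]; linarith
    have g2 : Real.exp (-(1/8) * (T:ℝ)^(ε/2)) ≤
        Real.exp (-c * min ((T : ℝ) ^ (ε / 2)) κ) := by
      apply Real.exp_le_exp.2
      have : c * min ((T : ℝ) ^ (ε / 2)) κ ≤ (1/8) * (T:ℝ)^(ε/2) :=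
        mul_le_mul hc3 hm1 hm0 (by norm_num)
      linarith
    have g3 : Real.exp (lam * (1-1)) = 1 := by simp
    rw [g3, one_mul]
    linarith
  rw [tsub_le_iff_right]
  calc (1:ℝ≥0∞) = P Set.univ := measure_univ.symm
    _ ≤ P ({ω | θ ≤ capacity d {z | ∃ i < N ω, ∃ t, 1 ≤ t ∧ t ≤ T ∧ X i t ω = z}} ∪ bad) := by
        apply measure_mono
        intro ω _
        exact le_or_gt θ _
    _ ≤ _ := measure_union_le _ _
    _ ≤ _ := by gcongr
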